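/- arXiv:1105.5128 — 6 statements merged into one kernel-verified Lean document; each statement's English description precedes it below -/
import Mathlib

section
/- Let τ₀ > 0, α < 0, and f, g ∈ C⁰([0,τ₀]). Suppose ψ ∈ C²((0,τ₀)) extends continuously to [0,τ₀) and solves ψ″(τ) + (α τ^{−1} + g(τ)) ψ′(τ) + τ^{−1} f(τ) ψ(τ) = 0 for 0 < τ < τ₀. Then either ψ(0) ≠ 0, or there exists a constant C > 0 such that |ψ(τ)| ≤ C τ^{1−α} and |ψ′(τ)| ≤ C τ^{−α} for all τ ∈ (0, τ₀/2]. -/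
open Real MeasureTheory Set

lemma abs_sub_le_sub_of_abs_deriv_le {w v w' v' : ℝ → ℝ} {s t : ℝ} (hst : s ≤ t)
    (hw : ∀ x ∈ Icc s t, HasDerivAt w (w' x) x) (hv : ∀ x ∈ Icc s t, HasDerivAt v (v' x) x)
    (h : ∀ x ∈ Icc s t, |w' x| ≤ v' x) : |w t - w s| ≤ v t - v s := by
  have hsub : MonotoneOn (fun x => v x - w x) (Icc s t) := by
    refine monotoneOn_of_hasDerivWithinAt_nonneg (f' := fun x => v' x - w' x) (convex_Icc s t)
      (fun x hx => ((hv x hx).sub (hw x hx)).continuousAt.continuousWithinAt) ?_ ?_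
    · intro x hx
      exact ((hv x (interior_subset hx)).sub (hw x (interior_subset hx))).hasDerivWithinAt
    · intro x hx
      have := (abs_le.1 (h x (interior_subset hx))).2
      linarith
  have hadd : MonotoneOn (fun x => v x + w x) (Icc s t) := by
    refine monotoneOn_of_hasDerivWithinAt_nonneg (f' := fun x => v' x + w' x) (convex_Icc s t)
      (fun x hx => ((hv x hx).add (hw x hx)).continuousAt.continuousWithinAt) ?_ ?_
    · intro x hx
      exact ((hv x (interior_subset hx)).add (hw x (interior_subset hx))).hasDerivWithinAt
    · intro x hx
      have := (abs_le.1 (h x (interior_subset hx))).1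
      linarith
  have h1 := hsub (left_mem_Icc.2 hst) (right_mem_Icc.2 hst) hst
  have h2 := hadd (left_mem_Icc.2 hst) (right_mem_Icc.2 hst) hst
  simp only at h1 h2
  exact abs_le.2 ⟨by linarith, by linarith⟩

lemma rpow_le_const_mul_rpow {p q T τ : ℝ} (hpq : p ≤ q) (hτ : τ ∈ Ioc 0 T) :
    τ ^ q ≤ T ^ (q - p) * τ ^ p := by
  have h : τ ^ q = τ ^ (q - p) * τ ^ p := by
    rw [← rpow_add hτ.1]
    ring_nf
  rw [h]
  exact mul_le_mul_of_nonneg_right (rpow_le_rpow hτ.1.le hτ.2 (sub_nonneg.2 hpq))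
    (rpow_nonneg hτ.1.le p)

lemma exists_hasDerivAt_of_continuousOn_Icc {g : ℝ → ℝ} {b : ℝ} (hb : 0 ≤ b)
    (hg : ContinuousOn g (Icc 0 b)) :
    ∃ G : ℝ → ℝ, Continuous G ∧ ∀ x ∈ Icc 0 b, HasDerivAt G (g x) x := by
  have hc : Continuous (IccExtend hb ((Icc 0 b).domRestrict g)) :=
    (continuousOn_iff_continuous_domRestrict.1 hg).Icc_extend'
  have hd : ∀ x, HasDerivAt (fun t => ∫ s in (0 : ℝ)..t, IccExtend hb ((Icc 0 b).domRestrict g) s)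
      (IccExtend hb ((Icc 0 b).domRestrict g) x) x := fun x => hc.integral_hasStrictDerivAt 0 x
        |>.hasDerivAt
  refine ⟨_, continuous_iff_continuousAt.2 fun x => (hd x).continuousAt, fun x hx => ?_⟩
  refine (hd x).congr_deriv ?_
  rw [IccExtend_of_mem hb _ hx, domRestrict_apply]

/-- The integrating factor `x ^ α * exp (G x)` turns a power bound on `ψ` into one on `ψ'`. -/
lemma abs_deriv_le_of_abs_le_rpow {α T k M F : ℝ} {f g G ψ : ℝ → ℝ} (hT : 0 < T)
    (hG : Continuous G) (hGd : ∀ x ∈ Ioc 0 T, HasDerivAt G (g x) x)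
    (hF : ∀ x ∈ Ioc 0 T, |f x| ≤ F)
    (hψ' : ∀ x ∈ Ioc 0 T, HasDerivAt (deriv ψ) (deriv (deriv ψ) x) x)
    (hode : ∀ x ∈ Ioc 0 T,
      deriv (deriv ψ) x + (α / x + g x) * deriv ψ x + (f x / x) * ψ x = 0)
    (hk : k + α ≠ 0) (hM : ∀ x ∈ Ioc 0 T, |ψ x| ≤ M * x ^ k) :
    ∃ c d : ℝ, 0 ≤ c ∧ 0 ≤ d ∧ ∀ x ∈ Ioc 0 T, |deriv ψ x| ≤ c * x ^ (-α) + d * x ^ k := by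
  obtain ⟨m, hm⟩ := (isCompact_Icc (a := (0 : ℝ)) (b := T)).exists_bound_of_continuousOn
    hG.continuousOn
  have hm' : ∀ x ∈ Ioc 0 T, |G x| ≤ m := fun x hx => hm x (Ioc_subset_Icc_self hx)
  set w : ℝ → ℝ := fun x => x ^ α * exp (G x) * deriv ψ x with hwdef
  have hw : ∀ x ∈ Ioc 0 T, HasDerivAt w (-(exp (G x) * x ^ (α - 1) * f x * ψ x)) x := by
    intro x hx
    have h1 := ((hasDerivAt_rpow_const (p := α) (Or.inl hx.1.ne')).mul (hGd x hx).exp).mul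
      (hψ' x hx)
    refine h1.congr_deriv ?_
    have h2 : deriv (deriv ψ) x = -((α / x + g x) * deriv ψ x + (f x / x) * ψ x) := by
      linarith [hode x hx]
    have hx0 := hx.1.ne'
    simp only [Pi.mul_apply]
    rw [h2, rpow_sub_one hx0]
    field_simp
    ring
  have hF0 : 0 ≤ F := (abs_nonneg _).trans (hF T ⟨hT, le_rfl⟩)
  set B := exp m * F * M with hB
  have hM0 : 0 ≤ M := by
    have := (abs_nonneg _).trans (hM T ⟨hT, le_rfl⟩)
    exact nonneg_of_mul_nonneg_left this (rpow_pos_of_pos hT k)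
  have hB0 : 0 ≤ B := by positivity
  set v : ℝ → ℝ := fun x => B / (k + α) * x ^ (k + α) with hvdef
  have hv : ∀ x ∈ Ioc 0 T, HasDerivAt v (B * x ^ (k + α - 1)) x := by
    intro x hx
    refine ((hasDerivAt_rpow_const (p := k + α) (Or.inl hx.1.ne')).const_mul
      (B / (k + α))).congr_deriv ?_
    field_simp
  have hwv : ∀ x ∈ Ioc 0 T,
      |(-(exp (G x) * x ^ (α - 1) * f x * ψ x))| ≤ B * x ^ (k + α - 1) := by
    intro x hx
    have hp := rpow_nonneg hx.1.le (α - 1)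
    have hk0 := rpow_nonneg hx.1.le k
    rw [abs_neg, abs_mul, abs_mul, abs_mul, abs_exp, abs_of_nonneg hp]
    calc exp (G x) * x ^ (α - 1) * |f x| * |ψ x|
        ≤ exp m * x ^ (α - 1) * F * (M * x ^ k) := by
          gcongr
          · exact (le_abs_self _).trans (hm' x hx)
          · exact hF x hx
          · exact hM x hx
      _ = B * x ^ (k + α - 1) := by
          rw [show k + α - 1 = (α - 1) + k by ring, rpow_add hx.1]
          ring
  refine ⟨exp m * (|w T| + |v T|), exp m * |B / (k + α)|, by positivity, by positivity, ?_⟩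
  intro x hx
  have hsub : Icc x T ⊆ Ioc 0 T := fun y hy => ⟨hx.1.trans_le hy.1, hy.2⟩
  have hdiff := abs_sub_le_sub_of_abs_deriv_le hx.2 (fun y hy => hw y (hsub hy))
    (fun y hy => hv y (hsub hy)) (fun y hy => hwv y (hsub hy))
  have hvx : |v x| = |B / (k + α)| * x ^ (k + α) := by
    rw [hvdef, abs_mul, abs_of_nonneg (rpow_nonneg hx.1.le (k + α))]
  have hwx : |w x| ≤ |w T| + |v T| + |B / (k + α)| * x ^ (k + α) := by
    rw [← hvx]
    have h1 := abs_sub_abs_le_abs_sub (w x) (w T)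
    rw [abs_sub_comm] at h1
    linarith [le_abs_self (v T), neg_abs_le (v x)]
  have hψw : deriv ψ x = exp (-G x) * x ^ (-α) * w x := by
    have h1 : exp (-G x) * exp (G x) = 1 := by rw [← exp_add]; simp
    have h2 : x ^ (-α) * x ^ α = 1 := by rw [← rpow_add hx.1]; simp
    calc deriv ψ x = (exp (-G x) * exp (G x)) * (x ^ (-α) * x ^ α) * deriv ψ x := by
          rw [h1, h2]; ring
      _ = _ := by rw [hwdef]; ring
  have hp := rpow_nonneg hx.1.le (-α)
  rw [hψw, abs_mul, abs_mul, abs_exp, abs_of_nonneg hp]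
  calc exp (-G x) * x ^ (-α) * |w x|
      ≤ exp m * x ^ (-α) * (|w T| + |v T| + |B / (k + α)| * x ^ (k + α)) := by
        gcongr
        exact (neg_le_abs _).trans (hm' x hx)
    _ = _ := by
        have : x ^ k = x ^ (-α) * x ^ (k + α) := by
          rw [← rpow_add hx.1]
          ring_nf
        rw [this]
        ring

lemma abs_le_rpow_of_abs_deriv_le {ψ : ℝ → ℝ} {T q c : ℝ} (hq : 0 ≤ q) (hc : 0 ≤ c)
    (h0 : ψ 0 = 0) (hcont : ContinuousOn ψ (Icc 0 T)) (hd : DifferentiableOn ℝ ψ (Ioo 0 T))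
    (h : ∀ x ∈ Ioc 0 T, |deriv ψ x| ≤ c * x ^ q) :
    ∀ x ∈ Ioc 0 T, |ψ x| ≤ c * x ^ (q + 1) := by
  intro x hx
  obtain ⟨y, hy, hslope⟩ := exists_deriv_eq_slope ψ hx.1
    (hcont.mono (Icc_subset_Icc_right hx.2)) (hd.mono (Ioo_subset_Ioo_right hx.2))
  have hψ : ψ x = deriv ψ y * x := by
    rw [hslope, h0]
    have := hx.1.ne'
    field_simp
    ring
  rw [hψ, abs_mul, abs_of_pos hx.1, rpow_add_one hx.1.ne', ← mul_assoc]
  refine mul_le_mul_of_nonneg_right ((h y ⟨hy.1, hy.2.le.trans hx.2⟩).trans ?_) hx.1.le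
  exact mul_le_mul_of_nonneg_left (rpow_le_rpow hy.1.le hy.2.le hq) hc

/-- Asymptotic dichotomy at a regular singular point for a second-order linear ODE
`ψ'' + (α/τ + g)ψ' + (f/τ)ψ = 0` with negative indicial coefficient `α < 0`:
either `ψ(0) ≠ 0`, or `|ψ(τ)| ≤ C τ^{1-α}` and `|ψ'(τ)| ≤ C τ^{-α}` near the origin. -/
theorem stmt3 (τ₀ α : ℝ) (hτ₀ : 0 < τ₀) (hα : α < 0)
    (f g ψ : ℝ → ℝ)
    (hf : ContinuousOn f (Icc 0 τ₀)) (hg : ContinuousOn g (Icc 0 τ₀))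
    (hψC2 : ContDiffOn ℝ 2 ψ (Ioo 0 τ₀))
    (hψcont : ContinuousOn ψ (Ico 0 τ₀))
    (hode : ∀ τ ∈ Ioo (0:ℝ) τ₀,
      deriv (deriv ψ) τ + (α/τ + g τ) * deriv ψ τ + (f τ/τ) * ψ τ = 0) :
    ψ 0 ≠ 0 ∨ ∃ C : ℝ, 0 < C ∧ ∀ τ ∈ Ioc (0:ℝ) (τ₀/2),
      |ψ τ| ≤ C * τ ^ (1-α) ∧ |deriv ψ τ| ≤ C * τ ^ (-α) := by
  by_cases h0 : ψ 0 = 0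
  swap
  · exact Or.inl h0
  right
  set T := τ₀ / 2 with hTdef
  have hT : 0 < T := half_pos hτ₀
  have hTτ : T < τ₀ := half_lt_self hτ₀
  have hsub : Ioc 0 T ⊆ Ioo 0 τ₀ := fun x hx => ⟨hx.1, hx.2.trans_lt hTτ⟩
  have hcont : ContinuousOn ψ (Icc 0 T) := hψcont.mono fun x hx => ⟨hx.1, hx.2.trans_lt hTτ⟩
  have hd : DifferentiableOn ℝ ψ (Ioo 0 T) :=
    (hψC2.differentiableOn (by norm_num)).mono (Ioo_subset_Ioo_right hTτ.le)
  have hψ' : ∀ x ∈ Ioc 0 T, HasDerivAt (deriv ψ) (deriv (deriv ψ) x) x := by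
    intro x hx
    have h1 : ContDiffOn ℝ 1 (deriv ψ) (Ioo 0 τ₀) :=
      hψC2.deriv_of_isOpen isOpen_Ioo (by norm_num)
    exact ((h1.differentiableOn (by norm_num)).differentiableAt
      (isOpen_Ioo.mem_nhds (hsub hx))).hasDerivAt
  obtain ⟨G, hG, hGd⟩ := exists_hasDerivAt_of_continuousOn_Icc hτ₀.le hg
  obtain ⟨F, hF⟩ := isCompact_Icc.exists_bound_of_continuousOn hf
  obtain ⟨M₀, hM₀⟩ := isCompact_Icc.exists_bound_of_continuousOn hcont
  have key : ∀ k M : ℝ, k + α ≠ 0 → (∀ x ∈ Ioc 0 T, |ψ x| ≤ M * x ^ k) →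
      ∃ c d : ℝ, 0 ≤ c ∧ 0 ≤ d ∧ ∀ x ∈ Ioc 0 T, |deriv ψ x| ≤ c * x ^ (-α) + d * x ^ k :=
    fun k M hk hM => abs_deriv_le_of_abs_le_rpow hT hG
      (fun x hx => hGd x (Ioo_subset_Icc_self (hsub hx)))
      (fun x hx => hF x (Ioo_subset_Icc_self (hsub hx))) hψ'
      (fun x hx => hode x (hsub hx)) hk hM
  obtain ⟨N, hN⟩ := exists_nat_ge (-α)
  -- The exponents `i * δ` increase in steps of at most one and skip the critical value `-α`.
  set δ : ℝ := -α / (N + 1 / 2) with hδdef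
  have hδ : 0 < δ := div_pos (by linarith) (by positivity)
  have hδ1 : δ ≤ 1 := by
    rw [hδdef, div_le_one (by positivity)]
    linarith
  have hδN : δ * (N + 1 / 2) = -α := div_mul_cancel₀ _ (by positivity)
  have hboot : ∀ i : ℕ, i ≤ N + 1 → ∃ M : ℝ, ∀ x ∈ Ioc 0 T, |ψ x| ≤ M * x ^ (i * δ) := by
    intro i
    induction i with
    | zero =>
      intro _
      exact ⟨M₀, fun x hx => by simpa using hM₀ x (Ioc_subset_Icc_self hx)⟩
    | succ i ih =>
      intro hi
      obtain ⟨M, hM⟩ := ih (by omega)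
      have hiN : (i : ℝ) ≤ N := by exact_mod_cast (by omega : i ≤ N)
      have hlt : i * δ < -α := by nlinarith
      obtain ⟨c, d, hc, hd0, hcd⟩ := key _ M (by linarith) hM
      have hc' : 0 ≤ c * T ^ (-α - i * δ) + d := by positivity
      have hb := abs_le_rpow_of_abs_deriv_le (q := i * δ) (by positivity) hc' h0 hcont hd
        (fun x hx => by
          have := mul_le_mul_of_nonneg_left (rpow_le_const_mul_rpow hlt.le hx) hc
          linarith [hcd x hx])
      refine ⟨(c * T ^ (-α - i * δ) + d) * T ^ (i * δ + 1 - (i + 1 : ℕ) * δ), fun x hx => ?_⟩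
      rw [mul_assoc]
      refine (hb x hx).trans (mul_le_mul_of_nonneg_left (rpow_le_const_mul_rpow ?_ hx) hc')
      push_cast
      linarith
  obtain ⟨M, hM⟩ := hboot (N + 1) le_rfl
  have hgt : -α < (N + 1 : ℕ) * δ := by
    push_cast
    nlinarith
  obtain ⟨c, d, hc, hd0, hcd⟩ := key _ M (by linarith) hM
  set C := c + d * T ^ ((N + 1 : ℕ) * δ - -α) with hCdef
  have hC : 0 ≤ C := by positivity
  have hder : ∀ x ∈ Ioc 0 T, |deriv ψ x| ≤ C * x ^ (-α) := fun x hx => by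
    have := mul_le_mul_of_nonneg_left (rpow_le_const_mul_rpow hgt.le hx) hd0
    rw [hCdef]
    linarith [hcd x hx]
  have hval := abs_le_rpow_of_abs_deriv_le (by linarith) hC h0 hcont hd hder
  refine ⟨C + 1, by linarith, fun x hx => ⟨?_, ?_⟩⟩
  · have := rpow_nonneg hx.1.le (1 - α)
    have h1 := hval x hx
    rw [show -α + 1 = 1 - α by ring] at h1
    linarith
  · have := rpow_nonneg hx.1.le (-α)
    linarith [hder x hx]
end

section
/- Let z₀ > 0, μ ∈ ℝ, let X, X₀ : [0,z₀] → ℝ be continuously differentiable with X(z) > 0 for all z ∈ [0,z₀], and let ϱ₀ : [0,z₀] → ℝ be continuous. Suppose φ ∈ C²((0,z₀)) extends continuously to [0,z₀) with φ(0) = 0 and solves φ″(z) + (X′(z)/X(z) − 2/z) φ′(z) − 4 (X₀′(z)/(z X(z))) φ(z) = −μ (ϱ₀(z)/X(z)) φ(z) for 0 < z < z₀. Then there exists C > 0 such that |φ(z)| ≤ C z³ and |φ′(z)| ≤ C z² for all z ∈ (0, z₀/2]. -/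
open Real MeasureTheory Set

/-- A function whose derivative is `O(s ^ (b - 1))`, `b ≠ 0`, is `O(1 + s ^ b)`. -/
lemma abs_le_of_abs_deriv_le_rpow {w w' : ℝ → ℝ} {c b z z₁ : ℝ} (hb : b ≠ 0) (hz : 0 < z)
    (hzz : z ≤ z₁) (hw : ∀ s ∈ Icc z z₁, HasDerivAt w (w' s) s)
    (hw' : ∀ s ∈ Icc z z₁, |w' s| ≤ c * s ^ (b - 1)) :
    |w z| ≤ |w z₁| + c / |b| * (z₁ ^ b + z ^ b) := by
  have hz₁ : 0 < z₁ := hz.trans_le hzz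
  have hc : 0 ≤ c := by
    have h := (abs_nonneg _).trans (hw' z ⟨le_rfl, hzz⟩)
    exact nonneg_of_mul_nonneg_left h (rpow_pos_of_pos hz _)
  have hb' : 0 < |b| := abs_pos.2 hb
  have h1 : 0 < z₁ ^ b := rpow_pos_of_pos hz₁ _
  have h2 : 0 < z ^ b := rpow_pos_of_pos hz _
  rcases hzz.eq_or_lt with rfl | hlt
  · have : 0 ≤ c / |b| * (z ^ b + z ^ b) := by positivity
    linarith
  obtain ⟨s, hs, hslope⟩ := exists_ratio_hasDerivAt_eq_ratio_slope w w' hlt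
    (fun s hs => (hw s hs).continuousAt.continuousWithinAt)
    (fun s hs => hw s (Ioo_subset_Icc_self hs)) (fun s => s ^ b) (fun s => b * s ^ (b - 1))
    (fun s hs => (continuousAt_rpow_const s b
      (Or.inl (hz.trans_le hs.1).ne')).continuousWithinAt)
    (fun s hs => hasDerivAt_rpow_const (Or.inl (hz.trans hs.1).ne'))
  have hs0 : 0 < s ^ (b - 1) := rpow_pos_of_pos (hz.trans hs.1) _
  have hdiff : |z₁ ^ b - z ^ b| ≤ z₁ ^ b + z ^ b := by
    rw [abs_le]; constructor <;> linarith
  have habs : |z₁ ^ b - z ^ b| * |w' s| = |w z₁ - w z| * (|b| * s ^ (b - 1)) := by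
    rw [← abs_of_pos hs0, ← abs_mul b, ← abs_mul, ← abs_mul, hslope]
  have hle : |w z₁ - w z| * |b| ≤ c * (z₁ ^ b + z ^ b) := by
    refine le_of_mul_le_mul_right ?_ hs0
    calc |w z₁ - w z| * |b| * s ^ (b - 1) = |z₁ ^ b - z ^ b| * |w' s| := by rw [habs]; ring
      _ ≤ (z₁ ^ b + z ^ b) * (c * s ^ (b - 1)) :=
        mul_le_mul hdiff (hw' s (Ioo_subset_Icc_self hs)) (abs_nonneg _) (by positivity)
      _ = c * (z₁ ^ b + z ^ b) * s ^ (b - 1) := by ring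
  have hle' : |w z₁ - w z| ≤ c / |b| * (z₁ ^ b + z ^ b) := by
    rw [div_mul_eq_mul_div, le_div_iff₀ hb']
    exact hle
  have := abs_sub_abs_le_abs_sub (w z) (w z₁)
  rw [abs_sub_comm] at this
  linarith

lemma rpow_le_mul_rpow_of_le {z z₁ a e : ℝ} (hz : 0 < z) (hzz : z ≤ z₁) (hea : e ≤ a) :
    z ^ a ≤ z₁ ^ (a - e) * z ^ e := by
  calc z ^ a = z ^ (a - e) * z ^ e := by rw [← rpow_add hz]; congr 1; ring
    _ ≤ _ := by
      have := rpow_le_rpow hz.le hzz (sub_nonneg.2 hea)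
      gcongr

/-- Improvement of the vanishing rate at `0` for the first-order system
`φ' = O(z² w)`, `w' = O(z⁻³ φ)`. -/
lemma exists_vanishing_rate_improvement {φ φ' w w' : ℝ → ℝ} {z₁ M N a e K : ℝ} (hz₁ : 0 < z₁)
    (hM : 0 ≤ M) (hN : 0 ≤ N)
    (hφc : ContinuousOn φ (Icc 0 z₁)) (hφ0 : φ 0 = 0)
    (hφ : ∀ z ∈ Ioc 0 z₁, HasDerivAt φ (φ' z) z) (hw : ∀ z ∈ Ioc 0 z₁, HasDerivAt w (w' z) z)
    (hφ' : ∀ z ∈ Ioc 0 z₁, |φ' z| ≤ N * z ^ 2 * |w z|)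
    (hw' : ∀ z ∈ Ioc 0 z₁, |w' z| ≤ M * |φ z| / z ^ 3)
    (ha : a ≠ 2) (he : 0 ≤ e) (he2 : e ≤ 2) (hea : e ≤ a)
    (hK : ∀ z ∈ Ioc 0 z₁, |φ z| ≤ K * z ^ a) :
    ∃ K', 0 ≤ K' ∧ ∀ z ∈ Ioc 0 z₁, |φ' z| ≤ K' * z ^ e ∧ |φ z| ≤ K' * z ^ (e + 1) := by
  have hK0 : 0 ≤ K := nonneg_of_mul_nonneg_left
    ((abs_nonneg _).trans (hK z₁ ⟨hz₁, le_rfl⟩)) (rpow_pos_of_pos hz₁ _)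
  set D := M * K / |a - 2| with hD
  have hD0 : 0 ≤ D := by positivity
  set K' := N * ((|w z₁| + D * z₁ ^ (a - 2)) * z₁ ^ (2 - e) + D * z₁ ^ (a - e)) with hK'
  have hK'0 : 0 ≤ K' := by
    have := rpow_pos_of_pos hz₁ (a - 2)
    have := rpow_pos_of_pos hz₁ (2 - e)
    have := rpow_pos_of_pos hz₁ (a - e)
    positivity
  have hder : ∀ z ∈ Ioc 0 z₁, |φ' z| ≤ K' * z ^ e := by
    intro z hz
    have hbound := abs_le_of_abs_deriv_le_rpow (c := M * K) (sub_ne_zero.2 ha) hz.1 hz.2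
      (fun s hs => hw s ⟨hz.1.trans_le hs.1, hs.2⟩) (fun s hs => by
        have hs0 : 0 < s := hz.1.trans_le hs.1
        have hs' : s ∈ Ioc 0 z₁ := ⟨hs0, hs.2⟩
        refine (hw' s hs').trans ?_
        have hpow : s ^ (a - 2 - 1) = s ^ a / s ^ 3 := by
          rw [← rpow_natCast s 3, ← rpow_sub hs0]; congr 1; push_cast; ring
        rw [hpow, mul_assoc, mul_div_assoc, ← mul_div_assoc K]
        have := hK s hs'
        gcongr)
    have hzp : z ^ 2 * z ^ (a - 2) = z ^ a := by
      rw [← rpow_natCast z 2, ← rpow_add hz.1]; congr 1; push_cast; ring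
    have h2 := rpow_le_mul_rpow_of_le hz.1 hz.2 he2
    rw [rpow_two] at h2
    have h3 := rpow_le_mul_rpow_of_le hz.1 hz.2 hea
    have hpos := rpow_pos_of_pos hz₁ (a - 2)
    calc |φ' z| ≤ N * z ^ 2 * |w z| := hφ' z hz
      _ ≤ N * z ^ 2 * (|w z₁| + D * (z₁ ^ (a - 2) + z ^ (a - 2))) := by gcongr
      _ = N * ((|w z₁| + D * z₁ ^ (a - 2)) * z ^ 2 + D * z ^ a) := by rw [← hzp]; ring
      _ ≤ N * ((|w z₁| + D * z₁ ^ (a - 2)) * (z₁ ^ (2 - e) * z ^ e)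
            + D * (z₁ ^ (a - e) * z ^ e)) := by gcongr
      _ = K' * z ^ e := by rw [hK']; ring
  refine ⟨K', hK'0, fun z hz => ⟨hder z hz, ?_⟩⟩
  obtain ⟨s, hs, hslope⟩ := exists_hasDerivAt_eq_slope φ φ' hz.1
    (hφc.mono (Icc_subset_Icc_right hz.2)) (fun s hs => hφ s ⟨hs.1, hs.2.le.trans hz.2⟩)
  rw [hφ0, sub_zero, sub_zero, eq_div_iff hz.1.ne'] at hslope
  have hse : s ^ e ≤ z ^ e := rpow_le_rpow hs.1.le hs.2.le he
  have hs' := hder s ⟨hs.1, hs.2.le.trans hz.2⟩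
  calc |φ z| = |φ' s| * z := by rw [← hslope, abs_mul, abs_of_pos hz.1]
    _ ≤ K' * z ^ e * z := by
      have := hz.1.le
      gcongr
      exact hs'.trans (by gcongr)
    _ = K' * z ^ (e + 1) := by rw [rpow_add_one hz.1.ne']; ring

/-- A solution of the first-order system `φ' = O(z² w)`, `w' = O(z⁻³ φ)` with `φ 0 = 0`
vanishes cubically at `0`. -/
lemma exists_cubic_vanishing {φ φ' w w' : ℝ → ℝ} {z₁ M N : ℝ} (hz₁ : 0 < z₁)
    (hM : 0 ≤ M) (hN : 0 ≤ N)
    (hφc : ContinuousOn φ (Icc 0 z₁)) (hφ0 : φ 0 = 0)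
    (hφ : ∀ z ∈ Ioc 0 z₁, HasDerivAt φ (φ' z) z) (hw : ∀ z ∈ Ioc 0 z₁, HasDerivAt w (w' z) z)
    (hφ' : ∀ z ∈ Ioc 0 z₁, |φ' z| ≤ N * z ^ 2 * |w z|)
    (hw' : ∀ z ∈ Ioc 0 z₁, |w' z| ≤ M * |φ z| / z ^ 3) :
    ∃ C, 0 < C ∧ ∀ z ∈ Ioc 0 z₁, |φ z| ≤ C * z ^ 3 ∧ |φ' z| ≤ C * z ^ 2 := by
  obtain ⟨K₀, hK₀⟩ := isCompact_Icc.exists_bound_of_continuousOn hφc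
  have step : ∀ {K : ℝ} (a e : ℝ), a ≠ 2 → 0 ≤ e → e ≤ 2 → e ≤ a →
      (∀ z ∈ Ioc 0 z₁, |φ z| ≤ K * z ^ a) → ∃ K', 0 ≤ K' ∧
        ∀ z ∈ Ioc 0 z₁, |φ' z| ≤ K' * z ^ e ∧ |φ z| ≤ K' * z ^ (e + 1) :=
    fun a e => exists_vanishing_rate_improvement hz₁ hM hN hφc hφ0 hφ hw hφ' hw'
  obtain ⟨K₁, -, h₁⟩ := step (K := K₀) 0 0 (by norm_num) le_rfl (by norm_num) le_rfl
    (fun z hz => by simpa using hK₀ z (Ioc_subset_Icc_self hz))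
  obtain ⟨K₂, -, h₂⟩ := step (0 + 1) (1 / 2) (by norm_num) (by norm_num) (by norm_num)
    (by norm_num) (fun z hz => (h₁ z hz).2)
  obtain ⟨K₃, -, h₃⟩ := step (1 / 2 + 1) (3 / 2) (by norm_num) (by norm_num) (by norm_num)
    (by norm_num) (fun z hz => (h₂ z hz).2)
  obtain ⟨K₄, hK₄, h₄⟩ := step (3 / 2 + 1) 2 (by norm_num) (by norm_num) le_rfl
    (by norm_num) (fun z hz => (h₃ z hz).2)
  refine ⟨K₄ + 1, by positivity, fun z hz => ?_⟩
  obtain ⟨hd, hv⟩ := h₄ z hz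
  have hz3 : z ^ ((2 : ℝ) + 1) = z ^ 3 := by
    rw [← rpow_natCast z 3]; norm_num
  rw [hz3] at hv
  rw [rpow_two] at hd
  have := pow_pos hz.1 2
  have := pow_pos hz.1 3
  constructor <;> linarith

/-- Cubic vanishing rate at the origin for solutions of the growing-mode eigenvalue
equation `φ'' + (X'/X - 2/z)φ' - 4(X₀'/(zX))φ = -μ(ϱ₀/X)φ`: any `C²` solution on
`(0,z₀)` extending continuously to `0` with `φ(0) = 0` satisfies
`|φ(z)| ≤ C z³` and `|φ'(z)| ≤ C z²` near the origin. -/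
theorem stmt4 (z₀ μ : ℝ) (hz₀ : 0 < z₀)
    (X X₀ ϱ₀ φ : ℝ → ℝ)
    (hX : ContDiffOn ℝ 1 X (Icc 0 z₀))
    (hX₀ : ContDiffOn ℝ 1 X₀ (Icc 0 z₀))
    (hXpos : ∀ z ∈ Icc (0:ℝ) z₀, 0 < X z)
    (hϱ : ContinuousOn ϱ₀ (Icc 0 z₀))
    (hφC2 : ContDiffOn ℝ 2 φ (Ioo 0 z₀))
    (hφcont : ContinuousOn φ (Ico 0 z₀))
    (hφ0 : φ 0 = 0)
    (hode : ∀ z ∈ Ioo (0:ℝ) z₀,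
      deriv (deriv φ) z
        + (derivWithin X (Icc 0 z₀) z / X z - 2/z) * deriv φ z
        - 4 * (derivWithin X₀ (Icc 0 z₀) z / (z * X z)) * φ z
      = -μ * (ϱ₀ z / X z) * φ z) :
    ∃ C : ℝ, 0 < C ∧ ∀ z ∈ Ioc (0:ℝ) (z₀/2),
      |φ z| ≤ C * z^3 ∧ |deriv φ z| ≤ C * z^2 := by
  have hcX := hX.continuousOn
  have hcX₀' : ContinuousOn (derivWithin X₀ (Icc 0 z₀)) (Icc 0 z₀) :=
    hX₀.continuousOn_derivWithin (uniqueDiffOn_Icc hz₀) le_rfl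
  obtain ⟨M, hM⟩ := isCompact_Icc.exists_bound_of_continuousOn
    (f := fun z => 4 * derivWithin X₀ (Icc 0 z₀) z - μ * ϱ₀ z * z) (by fun_prop)
  obtain ⟨N, hN⟩ := isCompact_Icc.exists_bound_of_continuousOn
    (f := fun z => (X z)⁻¹) (hcX.inv₀ fun z hz => (hXpos z hz).ne')
  have h0 : (0 : ℝ) ∈ Icc 0 z₀ := ⟨le_rfl, hz₀.le⟩
  have hsub : ∀ z ∈ Ioc 0 (z₀ / 2), z ∈ Ioo 0 z₀ := fun z hz => ⟨hz.1, by linarith [hz.2]⟩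
  have hφd : ContDiffOn ℝ 1 (deriv φ) (Ioo 0 z₀) :=
    ((contDiffOn_succ_iff_deriv_of_isOpen (n := 1) isOpen_Ioo).1
      (by simpa [one_add_one_eq_two] using hφC2)).2.2
  refine exists_cubic_vanishing (M := M) (N := N)
    (w := fun z => X z * deriv φ z / z ^ 2)
    (w' := fun z => (4 * derivWithin X₀ (Icc 0 z₀) z - μ * ϱ₀ z * z) * φ z / z ^ 3)
    (half_pos hz₀) ((norm_nonneg _).trans (hM 0 h0)) ((norm_nonneg _).trans (hN 0 h0))
    (hφcont.mono fun z hz => ⟨hz.1, by linarith [hz.2]⟩) hφ0 ?_ ?_ ?_ ?_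
  · intro z hz
    exact ((hφC2.differentiableOn (by norm_num)).differentiableAt
      (isOpen_Ioo.mem_nhds (hsub z hz))).hasDerivAt
  · intro z hz
    have hz' := hsub z hz
    have hz0 : z ≠ 0 := hz.1.ne'
    have hXz : X z ≠ 0 := (hXpos z (Ioo_subset_Icc_self hz')).ne'
    have hXd : HasDerivAt X (derivWithin X (Icc 0 z₀) z) z :=
      ((hX.differentiableOn one_ne_zero) z (Ioo_subset_Icc_self hz')).hasDerivWithinAt.hasDerivAt
        (Icc_mem_nhds hz'.1 hz'.2)
    have hdd : HasDerivAt (deriv φ) (deriv (deriv φ) z) z :=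
      ((hφd.differentiableOn one_ne_zero).differentiableAt
        (isOpen_Ioo.mem_nhds hz')).hasDerivAt
    refine ((hXd.mul hdd).div (hasDerivAt_pow 2 z) (pow_ne_zero 2 hz0)).congr_deriv ?_
    have hode' : deriv (deriv φ) z = -μ * (ϱ₀ z / X z) * φ z
        + 4 * (derivWithin X₀ (Icc 0 z₀) z / (z * X z)) * φ z
        - (derivWithin X (Icc 0 z₀) z / X z - 2 / z) * deriv φ z := by
      linarith [hode z hz']
    rw [Pi.mul_apply, hode']
    field_simp
    ring
  · intro z hz
    have hz' := Ioo_subset_Icc_self (hsub z hz)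
    have hz0 : z ≠ 0 := hz.1.ne'
    have hXz := hXpos z hz'
    have hNz := hN z hz'
    calc |deriv φ z| = ‖(X z)⁻¹‖ * z ^ 2 * |X z * deriv φ z / z ^ 2| := by
          rw [norm_eq_abs, ← abs_of_nonneg (sq_nonneg z), ← abs_mul, ← abs_mul,
            abs_of_nonneg (sq_nonneg z)]
          congr 1
          field_simp
      _ ≤ N * z ^ 2 * |X z * deriv φ z / z ^ 2| := by gcongr
  · intro z hz
    have hMz := hM z (Ioo_subset_Icc_self (hsub z hz))
    have hz3 := pow_pos hz.1 3
    rw [norm_eq_abs] at hMz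
    rw [abs_div, abs_mul, abs_of_pos hz3]
    gcongr
end

section
/- Let R > 0, K > 0, γ ∈ (1,2), and δ̃, ε̃ > 0. Let ϱ₀ : [0,R] → ℝ be continuous, positive on [0,R) with ϱ₀(R) = 0, such that P₀ := K ϱ₀^γ is continuously differentiable on (0,R) with sup_{(0,R)} |P₀′| < ∞ and sup_{(0,R)} |P₀′/ϱ₀| < ∞. Let H be the class of functions φ : [0,R] → ℝ that are continuous, locally absolutely continuous on (0,R], with φ(0) = 0 and ∫₀^R |φ′(z)|² z^{−2} dz < ∞, and set A = {φ ∈ H : J(φ) = 1}, where J(φ) = ∫₀^R ϱ₀(z) |φ(z)|² z^{−2} dz and E(φ) = ∫₀^R [ (δ̃ + γP₀(z)) |φ′(z)|²/z² + (4ε̃/3) |φ′(z) − 3φ(z)/z|²/z² + 4 P₀′(z) |φ(z)|²/z³ ] dz. Then inf_{φ ∈ A} E(φ) > −∞ and the infimum is attained: there exists φ* ∈ A with E(φ*) = inf_{φ ∈ A} E(φ). -/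
open Real MeasureTheory Set

/-- Membership in the admissible class `H`: `φ` is continuous on `[0,R]`, vanishes at `0`,
is locally absolutely continuous on `(0,R]` with derivative `φ'` (encoded via the
fundamental theorem of calculus on compact subintervals of `(0,R]`), and has finite
weighted Dirichlet energy `∫₀^R |φ'|²/z² < ∞`. -/
def memH (R : ℝ) (φ φ' : ℝ → ℝ) : Prop :=
  ContinuousOn φ (Icc 0 R) ∧ φ 0 = 0 ∧
  (∀ a b : ℝ, 0 < a → a ≤ b → b ≤ R →
    IntervalIntegrable φ' volume a b ∧ φ b - φ a = ∫ t in a..b, φ' t) ∧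
  IntegrableOn (fun z => (φ' z)^2 / z^2) (Ioo 0 R)

/-- The constraint functional `J(φ) = ∫₀^R ϱ₀ |φ|²/z² dz`. -/
noncomputable def Jfun (R : ℝ) (ϱ₀ : ℝ → ℝ) (φ : ℝ → ℝ) : ℝ :=
  ∫ z in Ioo (0:ℝ) R, ϱ₀ z * (φ z)^2 / z^2

/-- The energy functional
`E(φ) = ∫₀^R [(δ̃ + γP₀)|φ'|²/z² + (4ε̃/3)|φ' - 3φ/z|²/z² + 4P₀'|φ|²/z³] dz`,
where `P₀ = K ϱ₀^γ`. -/
noncomputable def Efun (R K γ δt εt : ℝ) (ϱ₀ : ℝ → ℝ) (φ φ' : ℝ → ℝ) : ℝ :=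
  ∫ z in Ioo (0:ℝ) R,
    ((δt + γ * (K * ϱ₀ z ^ γ)) * (φ' z)^2 / z^2
      + (4*εt/3) * (φ' z - 3*φ z / z)^2 / z^2
      + 4 * deriv (fun y => K * ϱ₀ y ^ γ) z * (φ z)^2 / z^3)

open Filter Topology

lemma aecover_Ioc_div_add_one (R : ℝ) :
    AECover (volume.restrict (Ioc 0 R)) atTop (fun n : ℕ => Ioc (R / ((n : ℝ) + 1)) R) := by
  refine aecover_Ioc_of_Ioc ?_ tendsto_const_nhds
  exact tendsto_const_nhds.div_atTop (tendsto_atTop_add_const_right _ _ tendsto_natCast_atTop_atTop)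

lemma div_add_one_mem_Ioc {R : ℝ} (hR : 0 < R) (n : ℕ) : R / ((n : ℝ) + 1) ∈ Ioc 0 R := by
  refine ⟨by positivity, div_le_self hR.le ?_⟩
  have : (0 : ℝ) ≤ n := n.cast_nonneg
  linarith

namespace memH

variable {R : ℝ} {φ φ' : ℝ → ℝ}

lemma aestronglyMeasurable (h : memH R φ φ') (hR : 0 < R) :
    AEStronglyMeasurable φ' (volume.restrict (Ioc 0 R)) := by
  refine (aecover_Ioc_div_add_one R).aestronglyMeasurable fun n => ?_
  obtain ⟨h0, h1⟩ := div_add_one_mem_Ioc hR n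
  have := (h.2.2.1 _ R h0 h1 le_rfl).1
  rw [intervalIntegrable_iff_integrableOn_Ioc_of_le h1] at this
  rw [Measure.restrict_restrict measurableSet_Ioc, inter_eq_left.2 (Ioc_subset_Ioc_left h0.le)]
  exact this.aestronglyMeasurable

lemma integrableOn_energy (h : memH R φ φ') :
    IntegrableOn (fun z => (φ' z) ^ 2 / z ^ 2) (Ioc 0 R) :=
  (integrableOn_Ioc_iff_integrableOn_Ioo (by simp)).2 h.2.2.2

lemma memLp (h : memH R φ φ') (hR : 0 < R) :
    MemLp (fun z => φ' z / z) 2 (volume.restrict (Ioc 0 R)) := by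
  have hm : AEStronglyMeasurable (fun z => φ' z / z) (volume.restrict (Ioc 0 R)) :=
    ((h.aestronglyMeasurable hR).aemeasurable.div aemeasurable_id).aestronglyMeasurable
  rw [memLp_two_iff_integrable_sq hm]
  simpa only [div_pow, IntegrableOn] using h.integrableOn_energy

lemma integrableOn_deriv (h : memH R φ φ') (hR : 0 < R) : IntegrableOn φ' (Ioc 0 R) := by
  refine (h.integrableOn_energy.add (integrableOn_const (C := R ^ 2) (by simp))).mono'
    (h.aestronglyMeasurable hR) ?_
  filter_upwards [ae_restrict_mem measurableSet_Ioc] with z hz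
  have h1 : |φ' z| = z * |φ' z / z| := by
    rw [abs_div, abs_of_pos hz.1]; field_simp [hz.1.ne']
  have h2 : (φ' z) ^ 2 / z ^ 2 = |φ' z / z| ^ 2 := by rw [sq_abs, div_pow]
  have h3 : z ^ 2 ≤ R ^ 2 := pow_le_pow_left₀ hz.1.le hz.2 2
  simp only [Pi.add_apply, Real.norm_eq_abs]
  rw [h1, h2]
  nlinarith [sq_nonneg (z - |φ' z / z|), sq_nonneg z, sq_nonneg (φ' z / z), sq_abs (φ' z / z)]

lemma intervalIntegrable (h : memH R φ φ') (hR : 0 < R) {a b : ℝ}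
    (ha : 0 ≤ a) (hab : a ≤ b) (hb : b ≤ R) : IntervalIntegrable φ' volume a b := by
  rw [intervalIntegrable_iff_integrableOn_Ioc_of_le hab]
  exact (h.integrableOn_deriv hR).mono_set (Ioc_subset_Ioc ha hb)

lemma eq_integral (h : memH R φ φ') (hR : 0 < R) {z : ℝ} (hz : z ∈ Ioc 0 R) :
    φ z = ∫ t in (0 : ℝ)..z, φ' t := by
  have hc : ContinuousOn (fun a => φ a - ∫ t in (0 : ℝ)..a, φ' t) (Icc 0 R) := by
    refine h.1.sub ?_
    have := intervalIntegral.continuousOn_primitive_interval (μ := volume) (f := φ')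
      (a := 0) (b := R) (by
        rw [uIcc_of_le hR.le, integrableOn_Icc_iff_integrableOn_Ioc]
        exact h.integrableOn_deriv hR)
    rwa [uIcc_of_le hR.le] at this
  have hconst : ∀ a ∈ Ioc 0 z, φ a - ∫ t in (0 : ℝ)..a, φ' t = φ z - ∫ t in (0 : ℝ)..z, φ' t := by
    intro a ha
    have h1 := (h.2.2.1 a z ha.1 ha.2 hz.2).2
    have h2 := intervalIntegral.integral_add_adjacent_intervals
      (h.intervalIntegrable hR le_rfl ha.1.le (ha.2.trans hz.2))
      (h.intervalIntegrable hR ha.1.le ha.2 hz.2)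
    linarith
  have hsub : Ioc 0 z ⊆ Icc 0 R := fun a ha => ⟨ha.1.le, ha.2.trans hz.2⟩
  have ht := ((hc 0 ⟨le_rfl, hR.le⟩).mono hsub).tendsto
  have : (𝓝[Ioc 0 z] (0 : ℝ)).NeBot := by
    rw [nhdsWithin_Ioc_eq_nhdsGT hz.1]; infer_instance
  have ht' : Tendsto (fun a => φ a - ∫ t in (0 : ℝ)..a, φ' t) (𝓝[Ioc 0 z] 0)
      (𝓝 (φ z - ∫ t in (0 : ℝ)..z, φ' t)) := by
    refine tendsto_const_nhds.congr' ?_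
    filter_upwards [self_mem_nhdsWithin] with a ha using (hconst a ha).symm
  have := tendsto_nhds_unique ht ht'
  simp only [h.2.1, intervalIntegral.integral_same, sub_self] at this
  linarith

lemma sq_le_energy (h : memH R φ φ') (hR : 0 < R) {z : ℝ} (hz : z ∈ Ioc 0 R) :
    3 * (φ z ^ 2 / z ^ 3) ≤ ∫ t in (0 : ℝ)..z, (φ' t) ^ 2 / t ^ 2 := by
  have hz0 := hz.1
  have hu : IntervalIntegrable (fun t => (φ' t) ^ 2 / t ^ 2) volume 0 z := by
    rw [intervalIntegrable_iff_integrableOn_Ioc_of_le hz0.le]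
    exact h.integrableOn_energy.mono_set (Ioc_subset_Ioc_right hz.2)
  set c := 3 * φ z / z ^ 3 with hc
  have hsq : IntervalIntegrable (fun t => c ^ 2 * t ^ 2) volume 0 z :=
    (by fun_prop : Continuous (fun t : ℝ => c ^ 2 * t ^ 2)).intervalIntegrable _ _
  have hp := (h.intervalIntegrable hR le_rfl hz0.le hz.2).const_mul (2 * c)
  have key : (0 : ℝ) ≤ ∫ t in (0 : ℝ)..z, (c ^ 2 * t ^ 2 - 2 * c * φ' t + (φ' t) ^ 2 / t ^ 2) := by
    refine intervalIntegral.integral_nonneg_of_ae_restrict hz0.le ?_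
    rw [Measure.restrict_congr_set Ioc_ae_eq_Icc.symm]
    filter_upwards [ae_restrict_mem measurableSet_Ioc] with t ht
    have : c ^ 2 * t ^ 2 - 2 * c * φ' t + (φ' t) ^ 2 / t ^ 2 = (c * t - φ' t / t) ^ 2 := by
      field_simp [ht.1.ne']
      ring
    rw [this]
    exact sq_nonneg _
  rw [intervalIntegral.integral_add (hsq.sub hp) hu, intervalIntegral.integral_sub hsq hp,
    intervalIntegral.integral_const_mul, intervalIntegral.integral_const_mul, integral_pow,
    ← h.eq_integral hR hz] at key
  have e : c ^ 2 * ((z ^ (2 + 1) - 0 ^ (2 + 1)) / ((2 : ℕ) + 1)) - 2 * c * φ z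
      = - (3 * (φ z ^ 2 / z ^ 3)) := by
    rw [hc]; push_cast; field_simp; ring
  rw [e] at key
  linarith

lemma integral_energy_mono (h : memH R φ φ') {z : ℝ} (hz : z ∈ Ioc 0 R) :
    ∫ t in (0 : ℝ)..z, (φ' t) ^ 2 / t ^ 2 ≤ ∫ t in Ioc 0 R, (φ' t) ^ 2 / t ^ 2 := by
  rw [intervalIntegral.integral_of_le hz.1.le]
  refine setIntegral_mono_set h.integrableOn_energy ?_ (Ioc_subset_Ioc_right hz.2).eventuallyLE
  exact Eventually.of_forall fun t => by positivity

lemma sq_div_le (h : memH R φ φ') (hR : 0 < R) {z : ℝ} (hz : z ∈ Ioc 0 R) :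
    φ z ^ 2 / z ^ 3 ≤ ∫ t in Ioc 0 R, (φ' t) ^ 2 / t ^ 2 := by
  have h1 := h.sq_le_energy hR hz
  have h2 := h.integral_energy_mono hz
  have h3 : 0 ≤ φ z ^ 2 / z ^ 3 := by have := hz.1; positivity
  linarith

lemma intervalIntegral_shear (h : memH R φ φ') {a : ℝ} (ha : a ∈ Ioc 0 R) :
    IntervalIntegrable (fun z => (φ' z - 3 * φ z / z) ^ 2 / z ^ 2) volume a R ∧
    ∫ z in a..R, (φ' z - 3 * φ z / z) ^ 2 / z ^ 2
      = (∫ z in a..R, (φ' z) ^ 2 / z ^ 2) - 3 * (φ R ^ 2 / R ^ 3) + 3 * (φ a ^ 2 / a ^ 3) := by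
  obtain ⟨ha0, haR⟩ := ha
  set ψ : ℝ → ℝ := fun x => φ a + ∫ t in a..x, φ' t with hψ
  have hInt₀ := (h.2.2.1 a R ha0 haR le_rfl).1
  have hψφ : ∀ x ∈ Icc a R, ψ x = φ x := fun x hx => by
    have := (h.2.2.1 a x ha0 hx.1 hx.2).2
    simp only [hψ]; linarith
  have hcd : ContDiffOn ℝ 1 (fun x : ℝ => (x ^ 3)⁻¹) (uIcc a R) := by
    rw [uIcc_of_le haR]
    exact (contDiffOn_id.pow 3).inv fun x hx => pow_ne_zero _ (ha0.trans_le hx.1).ne'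
  have hcst : AbsolutelyContinuousOnInterval (fun _ : ℝ => φ a) a R :=
    (contDiffOn_const (n := 1)).absolutelyContinuousOnInterval
  have hψac : AbsolutelyContinuousOnInterval ψ a R :=
    hcst.add (hInt₀.absolutelyContinuousOnInterval_intervalIntegral (c := a) left_mem_uIcc)
  have hF : AbsolutelyContinuousOnInterval (fun x => ψ x * ψ x * (x ^ 3)⁻¹) a R :=
    (hψac.fun_mul hψac).fun_mul hcd.absolutelyContinuousOnInterval
  have hderiv : ∀ᵐ x, x ∈ uIoc a R →
      deriv (fun x => ψ x * ψ x * (x ^ 3)⁻¹) x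
        = 2 * φ x * φ' x / x ^ 3 - 3 * φ x ^ 2 / x ^ 4 := by
    filter_upwards [hInt₀.ae_hasDerivAt_integral] with x hx hxm
    have hx1 := uIoc_subset_uIcc hxm
    have hd : HasDerivAt ψ (φ' x) x := (hx hx1 a left_mem_uIcc).const_add _
    rw [uIcc_of_le haR] at hx1
    have hx0 : x ≠ 0 := (ha0.trans_le hx1.1).ne'
    have hi : HasDerivAt (fun x : ℝ => (x ^ 3)⁻¹) (-(3 * x ^ 2) / (x ^ 3) ^ 2) x := by
      simpa using (hasDerivAt_pow 3 x).fun_inv (pow_ne_zero 3 hx0)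
    rw [((hd.fun_mul hd).fun_mul hi).deriv, hψφ x hx1]
    field_simp
    ring
  have hu : IntervalIntegrable (fun t => (φ' t) ^ 2 / t ^ 2) volume a R := by
    rw [intervalIntegrable_iff_integrableOn_Ioc_of_le haR]
    exact h.integrableOn_energy.mono_set (Ioc_subset_Ioc_left ha0.le)
  have hdi := hF.intervalIntegrable_deriv
  have hae : ∀ᵐ x, x ∈ uIoc a R → (φ' x) ^ 2 / x ^ 2
        - 3 * deriv (fun x => ψ x * ψ x * (x ^ 3)⁻¹) x = (φ' x - 3 * φ x / x) ^ 2 / x ^ 2 := by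
    filter_upwards [hderiv] with x hx hxm
    rw [hx hxm]
    rw [uIoc_of_le haR] at hxm
    have hx0 : x ≠ 0 := (ha0.trans hxm.1).ne'
    field_simp
    ring
  refine ⟨(hu.sub (hdi.const_mul 3)).congr_ae ?_, ?_⟩
  · exact (ae_restrict_iff' measurableSet_uIoc).2 hae
  rw [← intervalIntegral.integral_congr_ae hae,
    intervalIntegral.integral_sub hu (hdi.const_mul 3), intervalIntegral.integral_const_mul,
    hF.integral_deriv_eq_sub, hψφ R ⟨haR, le_rfl⟩, hψφ a ⟨le_rfl, haR⟩]
  ring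

lemma integral_shear (h : memH R φ φ') (hR : 0 < R) :
    IntegrableOn (fun z => (φ' z - 3 * φ z / z) ^ 2 / z ^ 2) (Ioc 0 R) ∧
    ∫ z in Ioc 0 R, (φ' z - 3 * φ z / z) ^ 2 / z ^ 2
      = (∫ z in Ioc 0 R, (φ' z) ^ 2 / z ^ 2) - 3 * (φ R ^ 2 / R ^ 3) := by
  set a : ℕ → ℝ := fun n => R / ((n : ℝ) + 1)
  have hm : ∀ n, a n ∈ Ioc 0 R := div_add_one_mem_Ioc hR
  have hcov : AECover (volume.restrict (Ioc 0 R)) atTop (fun n : ℕ => Ioc (a n) R) :=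
    aecover_Ioc_div_add_one R
  have hres : ∀ n, (volume.restrict (Ioc 0 R)).restrict (Ioc (a n) R)
      = volume.restrict (Ioc (a n) R) := fun n => by
    rw [Measure.restrict_restrict measurableSet_Ioc,
      inter_eq_left.2 (Ioc_subset_Ioc_left (hm n).1.le)]
  have hI : ∀ n, IntegrableOn (fun z => (φ' z - 3 * φ z / z) ^ 2 / z ^ 2) (Ioc (a n) R) :=
    fun n => (intervalIntegrable_iff_integrableOn_Ioc_of_le (hm n).2).1
      (h.intervalIntegral_shear (hm n)).1
  have hval : ∀ n, ∫ z in Ioc (a n) R, (φ' z - 3 * φ z / z) ^ 2 / z ^ 2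
      = (∫ z in Ioc (a n) R, (φ' z) ^ 2 / z ^ 2) - 3 * (φ R ^ 2 / R ^ 3)
        + 3 * (φ (a n) ^ 2 / (a n) ^ 3) := fun n => by
    have := (h.intervalIntegral_shear (hm n)).2
    rwa [intervalIntegral.integral_of_le (hm n).2, intervalIntegral.integral_of_le (hm n).2] at this
  have htu : Tendsto (fun n => ∫ z in Ioc (a n) R, (φ' z) ^ 2 / z ^ 2) atTop
      (𝓝 (∫ z in Ioc 0 R, (φ' z) ^ 2 / z ^ 2)) := by
    have := hcov.integral_tendsto_of_countably_generated h.integrableOn_energy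
    simpa only [hres] using this
  have hsplit : ∀ n, ∫ t in (0 : ℝ)..a n, (φ' t) ^ 2 / t ^ 2
      = (∫ z in Ioc 0 R, (φ' z) ^ 2 / z ^ 2) - ∫ z in Ioc (a n) R, (φ' z) ^ 2 / z ^ 2 := fun n => by
    rw [← intervalIntegral.integral_of_le hR.le, ← intervalIntegral.integral_of_le (hm n).2,
      eq_sub_iff_add_eq, intervalIntegral.integral_add_adjacent_intervals]
    · rw [intervalIntegrable_iff_integrableOn_Ioc_of_le (hm n).1.le]
      exact h.integrableOn_energy.mono_set (Ioc_subset_Ioc_right (hm n).2)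
    · rw [intervalIntegrable_iff_integrableOn_Ioc_of_le (hm n).2]
      exact h.integrableOn_energy.mono_set (Ioc_subset_Ioc_left (hm n).1.le)
  have hzero : Tendsto (fun n => 3 * (φ (a n) ^ 2 / (a n) ^ 3)) atTop (𝓝 0) := by
    refine squeeze_zero (fun n => ?_) (fun n => h.sq_le_energy hR (hm n)) ?_
    · have := (hm n).1
      positivity
    · simp only [hsplit]
      have := htu.const_sub (∫ z in Ioc 0 R, (φ' z) ^ 2 / z ^ 2)
      rwa [sub_self] at this
  have hlim := (htu.sub_const (3 * (φ R ^ 2 / R ^ 3))).add hzero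
  simp only [← hval, add_zero] at hlim
  have hnn : 0 ≤ᵐ[volume.restrict (Ioc 0 R)] fun z => (φ' z - 3 * φ z / z) ^ 2 / z ^ 2 :=
    Eventually.of_forall fun z => by positivity
  have hInt : IntegrableOn (fun z => (φ' z - 3 * φ z / z) ^ 2 / z ^ 2) (Ioc 0 R) := by
    refine hcov.integrable_of_integral_tendsto_of_nonneg_ae _ (fun n => ?_) hnn
      (by simpa only [hres] using hlim)
    rw [IntegrableOn, hres]
    exact hI n
  refine ⟨hInt, tendsto_nhds_unique ?_ hlim⟩
  simpa only [hres] using hcov.integral_tendsto_of_countably_generated hInt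

end memH

/-- Bounded sequences in a separable real Hilbert space have weakly convergent subsequences. -/
lemma exists_subseq_tendsto_inner {X : Type*} [NormedAddCommGroup X] [InnerProductSpace ℝ X]
    [CompleteSpace X] [TopologicalSpace.SeparableSpace X] {x : ℕ → X} {C : ℝ}
    (hx : ∀ n, ‖x n‖ ≤ C) :
    ∃ (y : X) (σ : ℕ → ℕ), StrictMono σ ∧
      ∀ f : X, Tendsto (fun n => inner ℝ (x (σ n)) f) atTop (𝓝 (inner ℝ y f)) := by
  obtain ⟨L, -, σ, hσ, hL⟩ := WeakDual.isSeqCompact_closedBall ℝ X 0 C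
    (x := fun n => StrongDual.toWeakDual (InnerProductSpace.toDual ℝ X (x n)))
    (fun n => by simpa using hx n)
  refine ⟨(InnerProductSpace.toDual ℝ X).symm (WeakDual.toStrongDual L), σ, hσ, fun f => ?_⟩
  have := ((WeakDual.eval_continuous f).tendsto L).comp hL
  simpa [Function.comp_def] using this

/-- Weak sequential compactness of bounded sets in `L²`, stated for functions. -/
lemma exists_subseq_tendsto_integral_mul {α : Type*} [MeasurableSpace α] {μ : Measure α}
    [IsSeparable μ] {g : ℕ → α → ℝ} (hg : ∀ n, MemLp (g n) 2 μ) {C : ℝ}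
    (hC : ∀ n, ∫ a, g n a ^ 2 ∂μ ≤ C) :
    ∃ (G : α → ℝ) (σ : ℕ → ℕ), StrictMono σ ∧ MemLp G 2 μ ∧ ∀ f : α → ℝ, MemLp f 2 μ →
      Tendsto (fun n => ∫ a, f a * g (σ n) a ∂μ) atTop (𝓝 (∫ a, f a * G a ∂μ)) := by
  have hinner : ∀ {f h : α → ℝ} (hf : MemLp f 2 μ) (hh : MemLp h 2 μ),
      inner ℝ (hh.toLp h) (hf.toLp f) = ∫ a, f a * h a ∂μ := fun hf hh => by
    rw [L2.inner_def]
    refine integral_congr_ae ?_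
    filter_upwards [hf.coeFn_toLp, hh.coeFn_toLp] with a h1 h2
    rw [h1, h2]
    simp
  have hnorm : ∀ n, ‖(hg n).toLp (g n)‖ ≤ √C := fun n => by
    refine Real.le_sqrt_of_sq_le ?_
    rw [← real_inner_self_eq_norm_sq, hinner]
    simpa only [sq] using hC n
  have : Fact ((2 : ENNReal) ≠ ⊤) := ⟨by simp⟩
  obtain ⟨y, σ, hσ, hy⟩ := exists_subseq_tendsto_inner hnorm
  refine ⟨y, σ, hσ, Lp.memLp y, fun f hf => ?_⟩
  have := hy (hf.toLp f)
  rw [← Lp.toLp_coeFn y (Lp.memLp y)] at this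
  simpa only [hinner] using this

lemma memH_integral {R : ℝ} (hR : 0 < R) {G : ℝ → ℝ}
    (hG : MemLp G 2 (volume.restrict (Ioc 0 R))) :
    memH R (fun z => ∫ t in (0 : ℝ)..z, t * G t) (fun z => z * G z) := by
  have hInt₀ : IntegrableOn (fun z => z * G z) (Ioc 0 R) := by
    refine (hG.integrable (by simp)).bdd_mul (c := R) aestronglyMeasurable_id ?_
    filter_upwards [ae_restrict_mem measurableSet_Ioc] with z hz
    simpa [abs_of_pos hz.1] using hz.2
  have hii : ∀ {a b : ℝ}, 0 ≤ a → a ≤ b → b ≤ R →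
      IntervalIntegrable (fun z => z * G z) volume a b := fun ha hab hb => by
    rw [intervalIntegrable_iff_integrableOn_Ioc_of_le hab]
    exact hInt₀.mono_set (Ioc_subset_Ioc ha hb)
  refine ⟨?_, by simp, fun a b ha hab hb => ⟨hii ha.le hab hb, ?_⟩, ?_⟩
  · have := intervalIntegral.continuousOn_primitive_interval (μ := volume)
      (f := fun z => z * G z) (a := 0) (b := R) (by
        rw [uIcc_of_le hR.le, integrableOn_Icc_iff_integrableOn_Ioc]
        exact hInt₀)
    rwa [uIcc_of_le hR.le] at this
  · have := intervalIntegral.integral_add_adjacent_intervals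
      (hii le_rfl ha.le (hab.trans hb)) (hii ha.le hab hb)
    simp only
    linarith
  · rw [← integrableOn_Ioc_iff_integrableOn_Ioo (by simp)]
    refine Integrable.congr hG.integrable_sq ?_
    filter_upwards [ae_restrict_mem measurableSet_Ioc] with z hz
    have := hz.1.ne'
    field_simp

namespace memH

variable {R : ℝ}

/-- Weak sequential compactness of energy-bounded sequences in `H`; weak convergence of the
derivatives forces pointwise convergence of the functions. -/
lemma exists_subseq_tendsto (hR : 0 < R) {φ φ' : ℕ → ℝ → ℝ} (h : ∀ n, memH R (φ n) (φ' n))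
    {C : ℝ} (hC : ∀ n, ∫ z in Ioc 0 R, (φ' n z) ^ 2 / z ^ 2 ≤ C) :
    ∃ (ψ ψ' : ℝ → ℝ) (σ : ℕ → ℕ), StrictMono σ ∧ memH R ψ ψ' ∧
      (∀ z ∈ Ioc 0 R, Tendsto (fun n => φ (σ n) z) atTop (𝓝 (ψ z))) ∧
      ∀ f : ℝ → ℝ, MemLp f 2 (volume.restrict (Ioc 0 R)) →
        Tendsto (fun n => ∫ z in Ioc 0 R, f z * (φ' (σ n) z / z)) atTop
          (𝓝 (∫ z in Ioc 0 R, f z * (ψ' z / z))) := by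
  obtain ⟨G, σ, hσ, hG, hlim⟩ := exists_subseq_tendsto_integral_mul (fun n => (h n).memLp hR)
    (C := C) (by simpa only [div_pow] using hC)
  have hψ := memH_integral hR hG
  have hlim' : ∀ f : ℝ → ℝ, MemLp f 2 (volume.restrict (Ioc 0 R)) →
      Tendsto (fun n => ∫ z in Ioc 0 R, f z * (φ' (σ n) z / z)) atTop
        (𝓝 (∫ z in Ioc 0 R, f z * (z * G z / z))) := fun f hf => by
    refine (hlim f hf).trans (le_of_eq ?_)
    congr 1
    refine setIntegral_congr_fun measurableSet_Ioc fun z hz => ?_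
    have := hz.1.ne'
    field_simp
  refine ⟨_, _, σ, hσ, hψ, fun z hz => ?_, hlim'⟩
  have hind : MemLp ((Iic z).indicator fun t => t) 2 (volume.restrict (Ioc 0 R)) := by
    refine MemLp.of_bound (measurable_id.indicator measurableSet_Iic).aestronglyMeasurable R ?_
    filter_upwards [ae_restrict_mem measurableSet_Ioc] with t ht
    refine (norm_indicator_le_norm_self _ _).trans ?_
    simpa [abs_of_pos ht.1] using ht.2
  have heval : ∀ {χ χ' : ℝ → ℝ}, memH R χ χ' →
      ∫ t in Ioc 0 R, (Iic z).indicator (fun t => t) t * (χ' t / t) = χ z := fun {χ χ'} hχ => by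
    rw [hχ.eq_integral hR hz, intervalIntegral.integral_of_le hz.1.le]
    have hset : Ioc 0 z = Ioc 0 R ∩ Iic z := by
      rw [Ioc_inter_Iic, min_eq_right hz.2]
    rw [hset, ← setIntegral_indicator measurableSet_Iic]
    refine setIntegral_congr_fun measurableSet_Ioc fun t ht => ?_
    have := ht.1.ne'
    by_cases htz : t ∈ Iic z
    · simp only [indicator_of_mem htz]
      field_simp
    · simp [indicator_of_notMem htz]
  have := hlim' _ hind
  simpa only [heval hψ, heval (h _)] using this

variable {φ φ' : ℝ → ℝ}

lemma integrableOn_mul_energy (h : memH R φ φ') {w : ℝ → ℝ} {M : ℝ}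
    (hw : AEStronglyMeasurable w (volume.restrict (Ioc 0 R)))
    (hwM : ∀ᵐ z ∂volume.restrict (Ioc 0 R), |w z| ≤ M) :
    IntegrableOn (fun z => w z * ((φ' z) ^ 2 / z ^ 2)) (Ioc 0 R) :=
  h.integrableOn_energy.bdd_mul hw hwM

lemma aestronglyMeasurable_sq_div (h : memH R φ φ') :
    AEStronglyMeasurable (fun z => φ z ^ 2 / z ^ 3) (volume.restrict (Ioc 0 R)) := by
  have := (h.1.mono Ioc_subset_Icc_self).aestronglyMeasurable (μ := volume) measurableSet_Ioc
  exact ((this.aemeasurable.pow_const 2).div (by fun_prop)).aestronglyMeasurable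

lemma norm_mul_sq_div_le (h : memH R φ φ') (hR : 0 < R) {z q Q C : ℝ} (hz : z ∈ Ioc 0 R)
    (hq : |q| ≤ Q) (hC : ∫ t in Ioc 0 R, (φ' t) ^ 2 / t ^ 2 ≤ C) :
    ‖q * (φ z ^ 2 / z ^ 3)‖ ≤ Q * C := by
  have h0 : 0 ≤ φ z ^ 2 / z ^ 3 := by have := hz.1; positivity
  rw [norm_mul, Real.norm_eq_abs, Real.norm_of_nonneg h0]
  exact mul_le_mul hq ((h.sq_div_le hR hz).trans hC) h0 ((abs_nonneg _).trans hq)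

lemma integrableOn_mul_sq_div (h : memH R φ φ') (hR : 0 < R) {q : ℝ → ℝ} {Q : ℝ}
    (hq : AEStronglyMeasurable q (volume.restrict (Ioc 0 R)))
    (hqQ : ∀ᵐ z ∂volume.restrict (Ioc 0 R), |q z| ≤ Q) :
    IntegrableOn (fun z => q z * (φ z ^ 2 / z ^ 3)) (Ioc 0 R) := by
  refine (integrable_const (Q * ∫ t in Ioc 0 R, (φ' t) ^ 2 / t ^ 2)).mono'
    (hq.mul h.aestronglyMeasurable_sq_div) ?_
  filter_upwards [hqQ, ae_restrict_mem measurableSet_Ioc] with z hz hzR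
  exact h.norm_mul_sq_div_le hR hzR hz le_rfl

lemma tendsto_integral_mul_sq_div (hR : 0 < R) {φ φ' : ℕ → ℝ → ℝ} {ψ : ℝ → ℝ}
    (h : ∀ n, memH R (φ n) (φ' n)) {C : ℝ}
    (hC : ∀ n, ∫ z in Ioc 0 R, (φ' n z) ^ 2 / z ^ 2 ≤ C)
    (hlim : ∀ z ∈ Ioc 0 R, Tendsto (fun n => φ n z) atTop (𝓝 (ψ z))) {q : ℝ → ℝ} {Q : ℝ}
    (hq : AEStronglyMeasurable q (volume.restrict (Ioc 0 R)))
    (hqQ : ∀ᵐ z ∂volume.restrict (Ioc 0 R), |q z| ≤ Q) :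
    Tendsto (fun n => ∫ z in Ioc 0 R, q z * (φ n z ^ 2 / z ^ 3)) atTop
      (𝓝 (∫ z in Ioc 0 R, q z * (ψ z ^ 2 / z ^ 3))) := by
  refine tendsto_integral_of_dominated_convergence (fun _ => Q * C)
    (fun n => hq.mul (h n).aestronglyMeasurable_sq_div) (integrable_const _) (fun n => ?_) ?_
  · filter_upwards [hqQ, ae_restrict_mem measurableSet_Ioc] with z hz hzR
    exact (h n).norm_mul_sq_div_le hR hzR hz (hC n)
  · filter_upwards [ae_restrict_mem measurableSet_Ioc] with z hz
    exact (((hlim z hz).pow 2).div_const _).const_mul _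

/-- Weak lower semicontinuity of the weighted Dirichlet energy. -/
lemma integral_mul_energy_le_of_tendsto (hR : 0 < R) {φ φ' : ℕ → ℝ → ℝ} {ψ ψ' : ℝ → ℝ}
    (h : ∀ n, memH R (φ n) (φ' n)) (hψ : memH R ψ ψ')
    (hlim : ∀ f : ℝ → ℝ, MemLp f 2 (volume.restrict (Ioc 0 R)) →
      Tendsto (fun n => ∫ z in Ioc 0 R, f z * (φ' n z / z)) atTop
        (𝓝 (∫ z in Ioc 0 R, f z * (ψ' z / z))))
    {w : ℝ → ℝ} {M L : ℝ} (hw : AEStronglyMeasurable w (volume.restrict (Ioc 0 R)))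
    (hw0 : ∀ᵐ z ∂volume.restrict (Ioc 0 R), 0 ≤ w z)
    (hwM : ∀ᵐ z ∂volume.restrict (Ioc 0 R), |w z| ≤ M)
    (hL : Tendsto (fun n => ∫ z in Ioc 0 R, w z * ((φ' n z) ^ 2 / z ^ 2)) atTop (𝓝 L)) :
    ∫ z in Ioc 0 R, w z * ((ψ' z) ^ 2 / z ^ 2) ≤ L := by
  have hf : MemLp (fun z => w z * (ψ' z / z)) 2 (volume.restrict (Ioc 0 R)) := by
    refine (hψ.memLp hR).of_le_mul (c := M) (hw.mul (hψ.memLp hR).1) ?_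
    filter_upwards [hwM] with z hz
    rw [norm_mul]
    exact mul_le_mul_of_nonneg_right hz (norm_nonneg _)
  have hl := ((hlim _ hf).const_mul 2).sub_const (∫ z in Ioc 0 R, w z * ((ψ' z) ^ 2 / z ^ 2))
  have heq : ∫ z in Ioc 0 R, w z * (ψ' z / z) * (ψ' z / z)
      = ∫ z in Ioc 0 R, w z * ((ψ' z) ^ 2 / z ^ 2) := by
    congr 1; ext z; ring
  rw [heq, two_mul, add_sub_cancel_right] at hl
  refine le_of_tendsto_of_tendsto' hl hL fun n => ?_
  have hi1 : IntegrableOn (fun z => w z * (ψ' z / z) * (φ' n z / z)) (Ioc 0 R) :=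
    hf.integrable_mul ((h n).memLp hR)
  rw [← integral_const_mul, ← integral_sub (hi1.const_mul 2) (hψ.integrableOn_mul_energy hw hwM)]
  refine integral_mono_ae ((hi1.const_mul 2).sub (hψ.integrableOn_mul_energy hw hwM))
    ((h n).integrableOn_mul_energy hw hwM) ?_
  filter_upwards [hw0] with z hz
  have := mul_nonneg hz (sq_nonneg (φ' n z / z - ψ' z / z))
  calc _ = w z * (φ' n z ^ 2 / z ^ 2) - w z * (φ' n z / z - ψ' z / z) ^ 2 := by ring
    _ ≤ _ := by linarith

end memH

/-- The energy functional with general weights: `w` on the Dirichlet density, a constant `c` on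
the shear density, and `4 d` on the zeroth-order density. -/
noncomputable def weightedEnergy (R c : ℝ) (w d φ φ' : ℝ → ℝ) : ℝ :=
  ∫ z in Ioo (0:ℝ) R,
    (w z * (φ' z)^2 / z^2 + c * (φ' z - 3*φ z / z)^2 / z^2 + 4 * d z * (φ z)^2 / z^3)

namespace memH

variable {R c δ M C₁ C₂ Q : ℝ} {w d ρ φ φ' : ℝ → ℝ}

lemma weightedEnergy_eq (h : memH R φ φ') (hR : 0 < R)
    (hw : AEStronglyMeasurable w (volume.restrict (Ioc 0 R)))
    (hwM : ∀ᵐ z ∂volume.restrict (Ioc 0 R), |w z| ≤ M)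
    (hd : AEStronglyMeasurable d (volume.restrict (Ioc 0 R)))
    (hdC : ∀ᵐ z ∂volume.restrict (Ioc 0 R), |d z| ≤ C₁) :
    weightedEnergy R c w d φ φ' = (∫ z in Ioc 0 R, w z * ((φ' z) ^ 2 / z ^ 2))
      + c * (∫ z in Ioc 0 R, (φ' z - 3 * φ z / z) ^ 2 / z ^ 2)
      + 4 * ∫ z in Ioc 0 R, d z * (φ z ^ 2 / z ^ 3) := by
  have h1 := h.integrableOn_mul_energy hw hwM
  have h2 := (h.integral_shear hR).1.const_mul c
  have h3 := (h.integrableOn_mul_sq_div hR hd hdC).const_mul 4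
  rw [weightedEnergy, ← integral_Ioc_eq_integral_Ioo, ← integral_const_mul, ← integral_const_mul,
    ← integral_add h1 h2]
  refine Eq.trans ?_ (integral_add (h1.add h2) h3)
  congr 1
  ext z
  ring

lemma weightedEnergy_eq_boundary (h : memH R φ φ') (hR : 0 < R)
    (hw : AEStronglyMeasurable w (volume.restrict (Ioc 0 R)))
    (hwM : ∀ᵐ z ∂volume.restrict (Ioc 0 R), |w z| ≤ M)
    (hd : AEStronglyMeasurable d (volume.restrict (Ioc 0 R)))
    (hdC : ∀ᵐ z ∂volume.restrict (Ioc 0 R), |d z| ≤ C₁) :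
    weightedEnergy R c w d φ φ' = (∫ z in Ioc 0 R, (w z + c) * ((φ' z) ^ 2 / z ^ 2))
      - 3 * c * (φ R ^ 2 / R ^ 3) + 4 * ∫ z in Ioc 0 R, d z * (φ z ^ 2 / z ^ 3) := by
  rw [h.weightedEnergy_eq hR hw hwM hd hdC, (h.integral_shear hR).2]
  simp only [add_mul]
  rw [integral_add (h.integrableOn_mul_energy hw hwM) (h.integrableOn_energy.const_mul c),
    integral_const_mul]
  ring

lemma Jfun_eq (R : ℝ) (ρ φ : ℝ → ℝ) :
    Jfun R ρ φ = ∫ z in Ioc 0 R, ρ z * z * (φ z ^ 2 / z ^ 3) := by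
  rw [Jfun, ← integral_Ioc_eq_integral_Ioo]
  refine setIntegral_congr_fun measurableSet_Ioc fun z hz => ?_
  have := hz.1.ne'
  field_simp

/-- Near the origin the zeroth-order density is controlled by the Dirichlet energy, and away from
it by the constraint density. -/
lemma neg_le_mul_sq_div (h : memH R φ φ') (hR : 0 < R) {z η a r : ℝ} (hz : z ∈ Ioc 0 R)
    (hη : 0 < η) (ha₁ : |a| ≤ C₁) (ha₂ : |a| ≤ C₂ * r) :
    -((Iic η).indicator (fun _ => C₁ * ∫ t in Ioc 0 R, (φ' t) ^ 2 / t ^ 2) z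
      + C₂ / η * (r * z * (φ z ^ 2 / z ^ 3))) ≤ a * (φ z ^ 2 / z ^ 3) := by
  have h0 : 0 ≤ φ z ^ 2 / z ^ 3 := by have := hz.1; positivity
  have hr : 0 ≤ C₂ * r := (abs_nonneg a).trans ha₂
  have hneg := mul_le_mul_of_nonneg_right (neg_abs_le a) h0
  have hr' : C₂ / η * (r * z * (φ z ^ 2 / z ^ 3)) = (C₂ * r) * (z / η) * (φ z ^ 2 / z ^ 3) := by
    ring
  have hz0 := hz.1
  by_cases hzη : z ∈ Iic η
  · rw [indicator_of_mem hzη, hr']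
    have h1 := h.norm_mul_sq_div_le hR hz ha₁ le_rfl
    rw [norm_mul, Real.norm_eq_abs, Real.norm_of_nonneg h0] at h1
    have h2 : 0 ≤ (C₂ * r) * (z / η) * (φ z ^ 2 / z ^ 3) := by positivity
    linarith
  · rw [indicator_of_notMem hzη, hr']
    have h1 : 1 ≤ z / η := (one_le_div hη).2 (not_le.1 hzη).le
    have h2 : |a| ≤ C₂ * r * (z / η) := ha₂.trans (le_mul_of_one_le_right hr h1)
    have h3 := mul_le_mul_of_nonneg_right h2 h0
    linarith

lemma exists_coercive (hR : 0 < R) (hδ : 0 < δ) (hc : 0 ≤ c)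
    (hw : AEStronglyMeasurable w (volume.restrict (Ioc 0 R)))
    (hwδ : ∀ᵐ z ∂volume.restrict (Ioc 0 R), δ ≤ w z)
    (hwM : ∀ᵐ z ∂volume.restrict (Ioc 0 R), |w z| ≤ M)
    (hd : AEStronglyMeasurable d (volume.restrict (Ioc 0 R)))
    (hC₁ : 0 ≤ C₁) (hdC : ∀ᵐ z ∂volume.restrict (Ioc 0 R), |d z| ≤ C₁)
    (hdρ : ∀ᵐ z ∂volume.restrict (Ioc 0 R), |d z| ≤ C₂ * ρ z)
    (hρ : AEStronglyMeasurable ρ (volume.restrict (Ioc 0 R)))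
    (hρQ : ∀ᵐ z ∂volume.restrict (Ioc 0 R), |ρ z * z| ≤ Q) :
    ∃ B, ∀ φ φ' : ℝ → ℝ, memH R φ φ' → Jfun R ρ φ = 1 →
      δ / 2 * ∫ z in Ioc 0 R, (φ' z) ^ 2 / z ^ 2 ≤ weightedEnergy R c w d φ φ' + B := by
  set η := min R (δ / (8 * (C₁ + 1)))
  have hη : 0 < η := lt_min hR (by positivity)
  have hηR : η ≤ R := min_le_left _ _
  refine ⟨4 * (C₂ / η), fun φ φ' h hJ => ?_⟩
  set D := ∫ z in Ioc 0 R, (φ' z) ^ 2 / z ^ 2 with hD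
  have hD0 : 0 ≤ D := integral_nonneg fun z => by positivity
  rw [h.weightedEnergy_eq hR hw hwM hd hdC]
  have hshear : 0 ≤ ∫ z in Ioc 0 R, (φ' z - 3 * φ z / z) ^ 2 / z ^ 2 :=
    integral_nonneg fun z => by positivity
  have hwint : δ * D ≤ ∫ z in Ioc 0 R, w z * ((φ' z) ^ 2 / z ^ 2) := by
    rw [hD, ← integral_const_mul]
    refine integral_mono_ae (h.integrableOn_energy.const_mul δ)
      (h.integrableOn_mul_energy hw hwM) ?_
    filter_upwards [hwδ] with z hz
    exact mul_le_mul_of_nonneg_right hz (by positivity)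
  have hind : IntegrableOn ((Iic η).indicator fun _ => C₁ * D) (Ioc 0 R) :=
    (integrable_const _).indicator measurableSet_Iic
  have hρi : IntegrableOn (fun z => ρ z * z * (φ z ^ 2 / z ^ 3)) (Ioc 0 R) :=
    h.integrableOn_mul_sq_div hR (hρ.mul aestronglyMeasurable_id) hρQ
  have hpot : -(η * (C₁ * D) + C₂ / η) ≤ ∫ z in Ioc 0 R, d z * (φ z ^ 2 / z ^ 3) := by
    have hval : ∫ z in Ioc 0 R, -((Iic η).indicator (fun _ => C₁ * D) z
        + C₂ / η * (ρ z * z * (φ z ^ 2 / z ^ 3))) = -(η * (C₁ * D) + C₂ / η) := by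
      rw [integral_neg, integral_add hind (hρi.const_mul _), integral_const_mul, ← Jfun_eq, hJ,
        setIntegral_indicator measurableSet_Iic, Ioc_inter_Iic, min_eq_right hηR,
        setIntegral_const, Real.volume_real_Ioc_of_le hη.le, sub_zero, smul_eq_mul, mul_one]
    rw [← hval]
    refine integral_mono_ae (hind.add (hρi.const_mul _)).neg
      (h.integrableOn_mul_sq_div hR hd hdC) ?_
    filter_upwards [hdC, hdρ, ae_restrict_mem measurableSet_Ioc] with z h1 h2 hz
    exact h.neg_le_mul_sq_div hR hz hη h1 h2
  have hsmall : 4 * (η * C₁) ≤ δ / 2 := by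
    have h1 : η * (8 * (C₁ + 1)) ≤ δ := (le_div_iff₀ (by positivity)).1 (min_le_right _ _)
    linarith
  have := mul_le_mul_of_nonneg_right hsmall hD0
  have := mul_nonneg hc hshear
  linarith

lemma const_mul_sq (R a : ℝ) : memH R (fun z => a * z ^ 2) (fun z => a * (2 * z)) := by
  have hcont : Continuous fun z : ℝ => a * (2 * z) := by fun_prop
  refine ⟨by fun_prop, by simp, fun x y _ _ _ => ⟨hcont.intervalIntegrable _ _, ?_⟩, ?_⟩
  · rw [intervalIntegral.integral_const_mul, intervalIntegral.integral_const_mul, integral_id]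
    ring
  · refine (integrableOn_const (C := 4 * a ^ 2) (s := Ioo 0 R) (by simp)).congr_fun
      (fun z hz => ?_) measurableSet_Ioo
    have := hz.1.ne'
    field_simp
    ring

lemma exists_Jfun_eq_one (hR : 0 < R) (hρ : AEStronglyMeasurable ρ (volume.restrict (Ioc 0 R)))
    (hρQ : ∀ᵐ z ∂volume.restrict (Ioc 0 R), |ρ z * z| ≤ Q) (hpos : ∀ z ∈ Ioo 0 R, 0 < ρ z) :
    ∃ φ φ' : ℝ → ℝ, memH R φ φ' ∧ Jfun R ρ φ = 1 := by
  have hscale : ∀ a, Jfun R ρ (fun z => a * z ^ 2) = a ^ 2 * Jfun R ρ (fun z => 1 * z ^ 2) :=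
    fun a => by
      rw [Jfun, Jfun, ← integral_const_mul]
      congr 1; ext z; ring
  have hJ : 0 < Jfun R ρ (fun z => 1 * z ^ 2) := by
    have hi := (const_mul_sq R 1).integrableOn_mul_sq_div hR (hρ.mul aestronglyMeasurable_id) hρQ
    have hpos' : ∀ z ∈ Ioo 0 R, 0 < ρ z * z * ((1 * z ^ 2) ^ 2 / z ^ 3) := fun z hz => by
      have := hpos z hz
      have := hz.1
      positivity
    rw [Jfun_eq, integral_Ioc_eq_integral_Ioo, setIntegral_pos_iff_support_of_nonneg_ae]
    · refine lt_of_lt_of_le ?_ (measure_mono fun z hz => ⟨(hpos' z hz).ne', hz⟩)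
      simpa using hR
    · filter_upwards [ae_restrict_mem measurableSet_Ioo] with z hz using (hpos' z hz).le
    · exact hi.mono_set Ioo_subset_Ioc_self
  refine ⟨_, _, const_mul_sq R (√(Jfun R ρ (fun z => 1 * z ^ 2)))⁻¹, ?_⟩
  rw [hscale, inv_pow, Real.sq_sqrt hJ.le, inv_mul_cancel₀ hJ.ne']

/-- Existence of a constrained minimizer for general weights (direct method). -/
lemma exists_minimizer (hR : 0 < R) (hδ : 0 < δ) (hc : 0 ≤ c)
    (hw : AEStronglyMeasurable w (volume.restrict (Ioc 0 R)))
    (hwδ : ∀ᵐ z ∂volume.restrict (Ioc 0 R), δ ≤ w z)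
    (hwM : ∀ᵐ z ∂volume.restrict (Ioc 0 R), |w z| ≤ M)
    (hd : AEStronglyMeasurable d (volume.restrict (Ioc 0 R)))
    (hC₁ : 0 ≤ C₁) (hdC : ∀ᵐ z ∂volume.restrict (Ioc 0 R), |d z| ≤ C₁)
    (hdρ : ∀ᵐ z ∂volume.restrict (Ioc 0 R), |d z| ≤ C₂ * ρ z)
    (hρ : AEStronglyMeasurable ρ (volume.restrict (Ioc 0 R)))
    (hρQ : ∀ᵐ z ∂volume.restrict (Ioc 0 R), |ρ z * z| ≤ Q) (hpos : ∀ z ∈ Ioo 0 R, 0 < ρ z) :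
    ∃ ψ ψ' : ℝ → ℝ, memH R ψ ψ' ∧ Jfun R ρ ψ = 1 ∧
      ∀ φ φ' : ℝ → ℝ, memH R φ φ' → Jfun R ρ φ = 1 →
        weightedEnergy R c w d ψ ψ' ≤ weightedEnergy R c w d φ φ' := by
  obtain ⟨B, hB⟩ := exists_coercive (c := c) hR hδ hc hw hwδ hwM hd hC₁ hdC hdρ hρ hρQ
  set S : Set ℝ := {e | ∃ φ φ' : ℝ → ℝ, memH R φ φ' ∧ Jfun R ρ φ = 1 ∧
    weightedEnergy R c w d φ φ' = e}
  have hne : S.Nonempty := by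
    obtain ⟨φ, φ', h, hJ⟩ := exists_Jfun_eq_one hR hρ hρQ hpos
    exact ⟨_, φ, φ', h, hJ, rfl⟩
  have hbdd : BddBelow S := by
    refine ⟨-B, ?_⟩
    rintro e ⟨φ, φ', h, hJ, rfl⟩
    have h0 : 0 ≤ ∫ z in Ioc 0 R, (φ' z) ^ 2 / z ^ 2 := integral_nonneg fun z => by positivity
    have := mul_nonneg (half_pos hδ).le h0
    linarith [hB φ φ' h hJ]
  obtain ⟨e, hanti, he, heS⟩ := exists_seq_tendsto_sInf hne hbdd
  choose φ φ' h hJ hE using heS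
  have hC : ∀ n, ∫ z in Ioc 0 R, (φ' n z) ^ 2 / z ^ 2 ≤ (e 0 + B) / (δ / 2) := fun n => by
    rw [le_div_iff₀' (half_pos hδ)]
    refine (hB _ _ (h n) (hJ n)).trans ?_
    rw [hE]
    linarith [hanti (Nat.zero_le n)]
  obtain ⟨ψ, ψ', σ, hσ, hψ, hpt, hweak⟩ := exists_subseq_tendsto hR h hC
  have hJlim := tendsto_integral_mul_sq_div hR (fun n => h (σ n)) (fun n => hC (σ n)) hpt
    (hρ.mul aestronglyMeasurable_id) hρQ
  have hJψ : Jfun R ρ ψ = 1 := by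
    rw [Jfun_eq]
    refine tendsto_nhds_unique hJlim (tendsto_const_nhds.congr fun n => ?_)
    rw [← hJ (σ n), Jfun_eq]
    rfl
  refine ⟨ψ, ψ', hψ, hJψ, fun χ χ' hχ hJχ => ?_⟩
  refine le_trans ?_ (csInf_le hbdd ⟨χ, χ', hχ, hJχ, rfl⟩)
  have hpot := (tendsto_integral_mul_sq_div hR (fun n => h (σ n)) (fun n => hC (σ n)) hpt
    hd hdC).const_mul 4
  have hbdry := (((hpt R ⟨hR, le_rfl⟩).pow 2).div_const (R ^ 3)).const_mul (3 * c)
  have hlim := ((he.comp hσ.tendsto_atTop).add hbdry).sub hpot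
  have hlsc := integral_mul_energy_le_of_tendsto (w := fun z => w z + c) (M := M + c) hR
    (fun n => h (σ n)) hψ hweak (hw.add aestronglyMeasurable_const)
    (by filter_upwards [hwδ] with z hz; linarith)
    (by
      filter_upwards [hwM] with z hz
      exact (abs_add_le _ _).trans (by rw [abs_of_nonneg hc]; linarith))
    (hlim.congr fun n => by
      rw [Function.comp_apply, ← hE, (h (σ n)).weightedEnergy_eq_boundary hR hw hwM hd hdC]
      ring)
  rw [hψ.weightedEnergy_eq_boundary hR hw hwM hd hdC]
  linarith

end memH

/-- Existence of a constrained minimizer: the energy `E` is bounded below on the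
constraint set `A = {φ ∈ H : J(φ) = 1}` and attains its infimum there. -/
theorem stmt5 (R K γ δt εt : ℝ) (hR : 0 < R) (hK : 0 < K)
    (hγ1 : 1 < γ) (hγ2 : γ < 2) (hδ : 0 < δt) (hε : 0 < εt)
    (ϱ₀ : ℝ → ℝ)
    (hϱcont : ContinuousOn ϱ₀ (Icc 0 R))
    (hϱpos : ∀ z ∈ Ico (0:ℝ) R, 0 < ϱ₀ z)
    (hϱR : ϱ₀ R = 0)
    (hP₀diff : ∀ z ∈ Ioo (0:ℝ) R, DifferentiableAt ℝ (fun y => K * ϱ₀ y ^ γ) z)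
    (hP₀deriv : ContinuousOn (deriv (fun y => K * ϱ₀ y ^ γ)) (Ioo 0 R))
    (C₁ C₂ : ℝ)
    (hbd1 : ∀ z ∈ Ioo (0:ℝ) R, |deriv (fun y => K * ϱ₀ y ^ γ) z| ≤ C₁)
    (hbd2 : ∀ z ∈ Ioo (0:ℝ) R, |deriv (fun y => K * ϱ₀ y ^ γ) z / ϱ₀ z| ≤ C₂) :
    ∃ φs φs' : ℝ → ℝ, memH R φs φs' ∧ Jfun R ϱ₀ φs = 1 ∧
      ∀ φ φ' : ℝ → ℝ, memH R φ φ' → Jfun R ϱ₀ φ = 1 →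
        Efun R K γ δt εt ϱ₀ φs φs' ≤ Efun R K γ δt εt ϱ₀ φ φ' := by
  have hae : ∀ {p : ℝ → Prop}, (∀ z ∈ Ioo 0 R, p z) → ∀ᵐ z ∂volume.restrict (Ioc 0 R), p z := by
    intro p hp
    rw [← Measure.restrict_congr_set (Ioo_ae_eq_Ioc (μ := volume) (a := (0 : ℝ)) (b := R))]
    exact (ae_restrict_mem measurableSet_Ioo).mono hp
  have hPcont : ContinuousOn (fun y => K * ϱ₀ y ^ γ) (Icc 0 R) :=
    continuousOn_const.mul (hϱcont.rpow_const fun _ _ => Or.inr (by linarith))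
  have hwcont : ContinuousOn (fun z => δt + γ * (K * ϱ₀ z ^ γ)) (Icc 0 R) :=
    continuousOn_const.add (continuousOn_const.mul hPcont)
  have hmeas : ∀ {f : ℝ → ℝ}, ContinuousOn f (Icc 0 R) →
      AEStronglyMeasurable f (volume.restrict (Ioc 0 R)) := fun hf =>
    (hf.mono Ioc_subset_Icc_self).aestronglyMeasurable measurableSet_Ioc
  obtain ⟨M, hM⟩ := isCompact_Icc.exists_bound_of_continuousOn hwcont
  obtain ⟨Q, hQ⟩ := isCompact_Icc.exists_bound_of_continuousOn (hϱcont.mul continuousOn_id)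
  have hpos : ∀ z ∈ Ioo 0 R, 0 < ϱ₀ z := fun z hz => hϱpos z (Ioo_subset_Ico_self hz)
  have hC₁ : 0 ≤ C₁ := (abs_nonneg _).trans (hbd1 (R / 2) ⟨by linarith, by linarith⟩)
  refine memH.exists_minimizer (c := 4 * εt / 3) (w := fun z => δt + γ * (K * ϱ₀ z ^ γ))
    (d := deriv fun y => K * ϱ₀ y ^ γ) hR hδ (by positivity) (hmeas hwcont)
    (hae fun z hz => ?_) (hae fun z hz => hM z (Ioo_subset_Icc_self hz))
    (measurable_deriv _).aestronglyMeasurable hC₁ (hae hbd1) (C₂ := C₂) (hae fun z hz => ?_)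
    (hmeas hϱcont) (hae fun z hz => hQ z (Ioo_subset_Icc_self hz)) hpos
  · have := (Real.rpow_pos_of_pos (hpos z hz) γ).le
    have : 0 ≤ γ * (K * ϱ₀ z ^ γ) := by positivity
    linarith
  · have := hbd2 z hz
    rwa [abs_div, abs_of_pos (hpos z hz), div_le_iff₀ (hpos z hz)] at this
end

section
/- Let R > 0, K > 0, δ > 0, ε > 0, s > 0, and 1 < γ < 4/3. Let ϱ₀ : [0,R] → ℝ be continuous, positive on [0,R) with ϱ₀(R) = 0, such that P₀ := K ϱ₀^γ is continuously differentiable on (0,R) with sup_{(0,R)} |P₀′| < ∞. With H, A, J as before (H the class of continuous φ : [0,R] → ℝ, locally absolutely continuous on (0,R], φ(0)=0, ∫₀^R |φ′|²/z² < ∞; J(φ) = ∫₀^R ϱ₀|φ|²/z²; A = {φ ∈ H : J(φ)=1}) and E(φ; s) = ∫₀^R [ s δ |φ′|²/z² + (4sε/3)|φ′ − 3φ/z|²/z² + γP₀|φ′|²/z² + 4P₀′|φ|²/z³ ] dz, the normalized test function φ̃(z) = z³ (∫₀^R ϱ₀(z) z⁴ dz)^{−1/2} belongs to A and satisfies E(φ̃;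 s) = s C₁ − C₂, where C₁ = 3δR³ (∫₀^R ϱ₀ z⁴ dz)^{−1} > 0 and C₂ = (∫₀^R (12 − 9γ) K ϱ₀^γ z² dz)(∫₀^R ϱ₀ z⁴ dz)^{−1} > 0. Consequently μ(s) := inf_{φ ∈ A} E(φ; s) ≤ s C₁ − C₂, and in particular μ(s) < 0 whenever 0 < s < C₂/C₁. -/
open Real MeasureTheory Set

/-- The energy functional of the relaxed problem with parameter `s`:
`E(φ; s) = ∫₀^R [sδ|φ'|²/z² + (4sε/3)|φ' - 3φ/z|²/z² + γP₀|φ'|²/z² + 4P₀'|φ|²/z³] dz`,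
where `P₀ = K ϱ₀^γ`. -/
noncomputable def Es (R K γ δ ε s : ℝ) (ϱ₀ : ℝ → ℝ) (φ φ' : ℝ → ℝ) : ℝ :=
  ∫ z in Ioo (0:ℝ) R,
    (s * δ * (φ' z)^2 / z^2
      + (4*s*ε/3) * (φ' z - 3*φ z / z)^2 / z^2
      + γ * (K * ϱ₀ z ^ γ) * (φ' z)^2 / z^2
      + 4 * deriv (fun y => K * ϱ₀ y ^ γ) z * (φ z)^2 / z^3)

open intervalIntegral

/-- The weighted Hardy-type pointwise bound `3 φ(b)² ≤ b³ ∫₀^R |φ'|²/z²` for `φ ∈ H`. -/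
lemma memH.three_mul_sq_le {R : ℝ} {φ φ' : ℝ → ℝ} (h : memH R φ φ') {b : ℝ}
    (hb : 0 < b) (hbR : b < R) :
    3 * (φ b) ^ 2 ≤ b ^ 3 * ∫ z in Ioo (0 : ℝ) R, (φ' z) ^ 2 / z ^ 2 := by
  obtain ⟨hc, h0, hac, hD⟩ := h
  set D := ∫ z in Ioo (0 : ℝ) R, (φ' z) ^ 2 / z ^ 2 with hDdef
  have key : ∀ x a : ℝ, a ∈ Ioo 0 b → 2 * x * (φ b - φ a) - x ^ 2 * (b ^ 3 - a ^ 3) / 3 ≤ D := by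
    intro x a ha
    obtain ⟨hi, he⟩ := hac a b ha.1 ha.2.le hbR.le
    have hsub : Ioc a b ⊆ Ioo 0 R := fun z hz => ⟨ha.1.trans hz.1, hz.2.trans_lt hbR⟩
    have hDab : IntervalIntegrable (fun z => (φ' z) ^ 2 / z ^ 2) volume a b := by
      rw [intervalIntegrable_iff_integrableOn_Ioc_of_le ha.2.le]
      exact hD.mono_set hsub
    have h1 : ∫ z in a..b, (φ' z) ^ 2 / z ^ 2 ≤ D := by
      rw [integral_of_le ha.2.le]
      refine setIntegral_mono_set hD ?_ hsub.eventuallyLE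
      exact Filter.Eventually.of_forall fun z => by positivity
    have h2 : ∫ z in a..b, (2 * x * φ' z - x ^ 2 * z ^ 2) ≤ ∫ z in a..b, (φ' z) ^ 2 / z ^ 2 := by
      refine integral_mono_on ha.2.le
        ((hi.const_mul (2 * x)).sub (Continuous.intervalIntegrable (by fun_prop) _ _)) hDab ?_
      intro z hz
      have hz0 : 0 < z := ha.1.trans_le hz.1
      rw [le_div_iff₀ (by positivity)]
      nlinarith [sq_nonneg (φ' z - x * z ^ 2)]
    rw [integral_sub (hi.const_mul (2 * x)) (Continuous.intervalIntegrable (by fun_prop) _ _),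
      intervalIntegral.integral_const_mul, intervalIntegral.integral_const_mul, ← he,
      integral_pow] at h2
    norm_num at h2
    linarith
  have lim : ∀ x : ℝ, 2 * x * φ b - x ^ 2 * b ^ 3 / 3 ≤ D := by
    intro x
    have hφ : Filter.Tendsto φ (nhdsWithin 0 (Ioo 0 b)) (nhds 0) := by
      have := hc 0 ⟨le_rfl, (hb.trans hbR).le⟩
      rw [ContinuousWithinAt, h0] at this
      exact this.mono_left (nhdsWithin_mono _ fun z hz => ⟨hz.1.le, (hz.2.trans hbR).le⟩)
    have hid : Filter.Tendsto (fun a : ℝ => a) (nhdsWithin 0 (Ioo 0 b)) (nhds 0) :=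
      nhdsWithin_le_nhds
    have ht : Filter.Tendsto (fun a => 2 * x * (φ b - φ a) - x ^ 2 * (b ^ 3 - a ^ 3) / 3)
        (nhdsWithin 0 (Ioo 0 b)) (nhds (2 * x * (φ b - 0) - x ^ 2 * (b ^ 3 - 0 ^ 3) / 3)) :=
      ((hφ.const_sub (φ b)).const_mul (2 * x)).sub
        ((((hid.pow 3).const_sub (b ^ 3)).const_mul (x ^ 2)).div_const 3)
    have : (nhdsWithin (0 : ℝ) (Ioo 0 b)).NeBot := left_nhdsWithin_Ioo_neBot hb
    have := le_of_tendsto ht (eventually_nhdsWithin_of_forall fun a ha => key x a ha)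
    simpa using this
  have hb3 : 0 < b ^ 3 := by positivity
  have := lim (3 * φ b / b ^ 3)
  have e : 2 * (3 * φ b / b ^ 3) * φ b - (3 * φ b / b ^ 3) ^ 2 * b ^ 3 / 3
      = 3 * φ b ^ 2 / b ^ 3 := by
    field_simp
    ring
  rw [e, div_le_iff₀ hb3] at this
  linarith

/-- The energy is bounded below on the constraint set. -/
lemma bddBelow_Es {R K γ δ ε s : ℝ} (hR : 0 < R) (hK : 0 < K) (hδ : 0 < δ) (hε : 0 < ε)
    (hs : 0 < s) (hγ : 0 < γ) {ϱ₀ : ℝ → ℝ} (hϱcont : ContinuousOn ϱ₀ (Icc 0 R))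
    (hϱpos : ∀ z ∈ Ico (0 : ℝ) R, 0 < ϱ₀ z) {Cb : ℝ}
    (hbd : ∀ z ∈ Ioo (0 : ℝ) R, |deriv (fun y => K * ϱ₀ y ^ γ) z| ≤ Cb) :
    BddBelow ((fun p : (ℝ → ℝ) × (ℝ → ℝ) => Es R K γ δ ε s ϱ₀ p.1 p.2) ''
        {p | memH R p.1 p.2 ∧ Jfun R ϱ₀ p.1 = 1}) := by
  have hCb : 0 ≤ Cb := (abs_nonneg _).trans (hbd (R / 2) ⟨by linarith, by linarith⟩)
  obtain ⟨η, hη, hηR, hηC⟩ : ∃ η : ℝ, 0 < η ∧ η < R / 2 ∧ 4 * Cb / 3 * (2 * η) ≤ s * δ := by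
    refine ⟨min (R / 4) (s * δ / (8 * (Cb + 1) / 3)), by positivity,
      (min_le_left _ _).trans_lt (by linarith), ?_⟩
    have h := min_le_right (R / 4) (s * δ / (8 * (Cb + 1) / 3))
    rw [le_div_iff₀ (by positivity)] at h
    have : 0 < min (R / 4) (s * δ / (8 * (Cb + 1) / 3)) := by positivity
    nlinarith
  have hsubm : Icc η (R - η) ⊆ Icc 0 R := Icc_subset_Icc hη.le (by linarith)
  obtain ⟨m, hm, hmle⟩ : ∃ m : ℝ, 0 < m ∧ ∀ z ∈ Icc η (R - η), m ≤ ϱ₀ z := by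
    obtain ⟨z₀, hz₀, hmin⟩ := isCompact_Icc.exists_isMinOn
      (nonempty_Icc.2 (by linarith : η ≤ R - η)) (hϱcont.mono hsubm)
    exact ⟨ϱ₀ z₀, hϱpos _ ⟨hη.le.trans hz₀.1, by linarith [hz₀.2]⟩, fun z hz => hmin hz⟩
  set M : ℝ := 4 * Cb / (m * η) with hM
  have hM0 : 0 ≤ M := by positivity
  refine ⟨-M, ?_⟩
  rintro _ ⟨⟨φ, φ'⟩, ⟨hH, hJ⟩, rfl⟩
  have hhardy := fun b hb hbR => hH.three_mul_sq_le (b := b) hb hbR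
  have hD := hH.2.2.2
  simp only at hH hJ hhardy hD ⊢
  set D := ∫ z in Ioo (0 : ℝ) R, (φ' z) ^ 2 / z ^ 2 with hDdef
  have hD0 : 0 ≤ D := integral_nonneg fun z => by positivity
  unfold Jfun at hJ
  have hJi : IntegrableOn (fun z => ϱ₀ z * (φ z) ^ 2 / z ^ 2) (Ioo 0 R) := by
    by_contra hn
    rw [integral_undef hn] at hJ
    exact zero_ne_one hJ
  unfold Es
  by_cases hE : IntegrableOn (fun z => s * δ * (φ' z)^2 / z^2
      + (4*s*ε/3) * (φ' z - 3*φ z / z)^2 / z^2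
      + γ * (K * ϱ₀ z ^ γ) * (φ' z)^2 / z^2
      + 4 * deriv (fun y => K * ϱ₀ y ^ γ) z * (φ z)^2 / z^3) (Ioo 0 R)
  swap
  · rw [integral_undef hE]
    linarith
  set S : Set ℝ := Ioo 0 η ∪ Ioo (R - η) R with hS
  have hSm : MeasurableSet S := measurableSet_Ioo.union measurableSet_Ioo
  have hSR : S ⊆ Ioo 0 R := by
    rintro z (hz | hz)
    · exact ⟨hz.1, by linarith [hz.2]⟩
    · exact ⟨by linarith [hz.1], hz.2⟩
  have hSvol : volume.real S ≤ 2 * η := by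
    refine (measureReal_union_le _ _).trans ?_
    rw [Real.volume_real_Ioo_of_le hη.le, Real.volume_real_Ioo_of_le (by linarith)]
    linarith
  have hSfin : volume S ≠ ⊤ := ((measure_mono hSR).trans_lt measure_Ioo_lt_top).ne
  have hind : IntegrableOn (S.indicator fun _ => 4 * Cb / 3 * D) (Ioo 0 R) :=
    ((integrable_indicator_iff hSm).2 (integrableOn_const hSfin)).integrableOn
  have hint : ∫ z in Ioo 0 R, S.indicator (fun _ => 4 * Cb / 3 * D) z
      = volume.real S * (4 * Cb / 3 * D) := by
    rw [setIntegral_indicator hSm, inter_eq_self_of_subset_right hSR, setIntegral_const, smul_eq_mul]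
  have hlow : ∫ z in Ioo 0 R, (s * δ * ((φ' z) ^ 2 / z ^ 2) - M * (ϱ₀ z * (φ z) ^ 2 / z ^ 2)
      - S.indicator (fun _ => 4 * Cb / 3 * D) z) = s * δ * D - M * 1
        - volume.real S * (4 * Cb / 3 * D) := by
    have hDJ : IntegrableOn
        (fun z => s * δ * ((φ' z) ^ 2 / z ^ 2) - M * (ϱ₀ z * (φ z) ^ 2 / z ^ 2)) (Ioo 0 R) :=
      (hD.const_mul _).sub (hJi.const_mul _)
    rw [MeasureTheory.integral_sub hDJ hind,
      MeasureTheory.integral_sub (hD.const_mul _) (hJi.const_mul _),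
      MeasureTheory.integral_const_mul, MeasureTheory.integral_const_mul, hJ, hint]
  have hfin : -M ≤ s * δ * D - M * 1 - volume.real S * (4 * Cb / 3 * D) := by
    have h1 : volume.real S * (4 * Cb / 3 * D) ≤ 2 * η * (4 * Cb / 3 * D) :=
      mul_le_mul_of_nonneg_right hSvol (by positivity)
    have h2 := mul_le_mul_of_nonneg_right hηC hD0
    linarith
  refine (hfin.trans_eq hlow.symm).trans ?_
  refine setIntegral_mono_on (((hD.const_mul _).sub (hJi.const_mul _)).sub hind) hE
    measurableSet_Ioo fun z hz => ?_
  have hz0 : 0 < z := hz.1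
  have hϱz : 0 < ϱ₀ z := hϱpos z ⟨hz.1.le, hz.2⟩
  have hvisc : 0 ≤ (4*s*ε/3) * (φ' z - 3*φ z / z)^2 / z^2 := by positivity
  have hpress : 0 ≤ γ * (K * ϱ₀ z ^ γ) * (φ' z)^2 / z^2 := by positivity
  have hgrav : -(4 * Cb * ((φ z) ^ 2 / z ^ 3))
      ≤ 4 * deriv (fun y => K * ϱ₀ y ^ γ) z * (φ z)^2 / z^3 := by
    have h1 := neg_le_of_abs_le (hbd z hz)
    have h2 : 0 ≤ (φ z) ^ 2 / z ^ 3 := by positivity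
    have h3 := mul_le_mul_of_nonneg_right h1 h2
    rw [mul_div_assoc]
    linarith
  have hsplit : 4 * Cb * ((φ z) ^ 2 / z ^ 3) ≤ M * (ϱ₀ z * (φ z) ^ 2 / z ^ 2)
      + S.indicator (fun _ => 4 * Cb / 3 * D) z := by
    by_cases hzS : z ∈ S
    · rw [indicator_of_mem hzS]
      have h1 : (φ z) ^ 2 / z ^ 3 ≤ D / 3 := by
        rw [div_le_iff₀ (by positivity)]
        linarith [hhardy z hz.1 hz.2]
      have h2 := mul_le_mul_of_nonneg_left h1 (by positivity : 0 ≤ 4 * Cb)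
      have h3 : 0 ≤ M * (ϱ₀ z * (φ z) ^ 2 / z ^ 2) := by positivity
      linarith
    · rw [indicator_of_notMem hzS, add_zero]
      have hzη : η ≤ z := not_lt.1 fun h => hzS (Or.inl ⟨hz.1, h⟩)
      have hzR : z ≤ R - η := not_lt.1 fun h => hzS (Or.inr ⟨h, hz.2⟩)
      have h1 : m * η ≤ ϱ₀ z * z :=
        mul_le_mul (hmle z ⟨hzη, hzR⟩) hzη hη.le hϱz.le
      have h2 : 4 * Cb ≤ M * (ϱ₀ z * z) := by
        rw [hM, div_mul_eq_mul_div, le_div_iff₀ (by positivity)]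
        exact mul_le_mul_of_nonneg_left h1 (by positivity)
      calc 4 * Cb * ((φ z) ^ 2 / z ^ 3) ≤ M * (ϱ₀ z * z) * ((φ z) ^ 2 / z ^ 3) :=
            mul_le_mul_of_nonneg_right h2 (by positivity)
        _ = M * (ϱ₀ z * (φ z) ^ 2 / z ^ 2) := by field_simp
  have e : s * δ * (φ' z) ^ 2 / z ^ 2 = s * δ * ((φ' z) ^ 2 / z ^ 2) := mul_div_assoc _ _ _
  linarith

/-- Cubic functions belong to `H`. -/
lemma memH_cubic (R c : ℝ) : memH R (fun z => z ^ 3 * c) (fun z => 3 * z ^ 2 * c) := by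
  refine ⟨by fun_prop, by simp, fun a b _ _ _ => ?_, ?_⟩
  · have hi : IntervalIntegrable (fun z : ℝ => 3 * z ^ 2 * c) volume a b :=
      Continuous.intervalIntegrable (by fun_prop) _ _
    refine ⟨hi, ?_⟩
    rw [integral_eq_sub_of_hasDerivAt (f := fun z => z ^ 3 * c) (fun z _ => ?_) hi]
    simpa using (hasDerivAt_pow 3 z).mul_const c
  · have hi : IntegrableOn (fun z : ℝ => 9 * z ^ 2 * c ^ 2) (Ioo 0 R) :=
      (Continuous.integrableOn_Icc (by fun_prop)).mono_set Ioo_subset_Icc_self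
    refine hi.congr_fun (fun z hz => ?_) measurableSet_Ioo
    have hz0 : z ≠ 0 := hz.1.ne'
    field_simp
    ring

/-- The integral over `(0,R)` of a function continuous on `[0,R]` and positive on `(0,R)`
is positive. -/
lemma setIntegral_Ioo_pos {R : ℝ} (hR : 0 < R) {f : ℝ → ℝ} (hf : ContinuousOn f (Icc 0 R))
    (hpos : ∀ z ∈ Ioo 0 R, 0 < f z) : 0 < ∫ z in Ioo 0 R, f z := by
  rw [← integral_Ioc_eq_integral_Ioo, ← integral_of_le hR.le]
  exact intervalIntegral_pos_of_pos_on (hf.intervalIntegrable_of_Icc hR.le) hpos hR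

/-- Integration by parts `∫₀^R 4 P' z³ = -12 ∫₀^R P z²`, valid when `P(R) = 0`. -/
lemma integral_four_mul_deriv_mul_cube {R Cb : ℝ} (hR : 0 < R) {P : ℝ → ℝ}
    (hP : ContinuousOn P (Icc 0 R)) (hPR : P R = 0)
    (hdiff : ∀ z ∈ Ioo 0 R, DifferentiableAt ℝ P z)
    (hbd : ∀ z ∈ Ioo 0 R, |deriv P z| ≤ Cb) :
    IntegrableOn (fun z => 4 * deriv P z * z ^ 3) (Ioo 0 R) ∧
      ∫ z in Ioo 0 R, 4 * deriv P z * z ^ 3 = -∫ z in Ioo 0 R, 12 * P z * z ^ 2 := by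
  have hd : IntegrableOn (deriv P) (Ioo 0 R) :=
    Measure.integrableOn_of_bounded measure_Ioo_lt_top.ne
      (measurable_deriv P).aestronglyMeasurable (M := Cb)
      ((ae_restrict_iff' measurableSet_Ioo).2 (Filter.Eventually.of_forall hbd))
  have h1 : IntegrableOn (fun z => 4 * deriv P z * z ^ 3) (Ioo 0 R) := by
    rw [← integrableOn_Icc_iff_integrableOn_Ioo] at hd ⊢
    exact IntegrableOn.mul_continuousOn (hd.const_mul 4) (by fun_prop) isCompact_Icc
  have h2 : IntegrableOn (fun z => 12 * P z * z ^ 2) (Ioo 0 R) :=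
    (ContinuousOn.integrableOn_Icc (by fun_prop)).mono_set Ioo_subset_Icc_self
  refine ⟨h1, ?_⟩
  have hprod : ∀ z ∈ Ioo 0 R, HasDerivAt (fun z => 4 * P z * z ^ 3)
      (4 * deriv P z * z ^ 3 + 12 * P z * z ^ 2) z := fun z hz => by
    refine (((hdiff z hz).hasDerivAt.const_mul 4).mul (hasDerivAt_pow 3 z)).congr_deriv ?_
    norm_num
    ring
  have hft := integral_eq_sub_of_hasDerivAt_of_le (f := fun z => 4 * P z * z ^ 3)
    (f' := fun z => 4 * deriv P z * z ^ 3 + 12 * P z * z ^ 2) hR.le (by fun_prop)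
    hprod
    (by
      rw [intervalIntegrable_iff_integrableOn_Ioo_of_le hR.le]
      exact h1.add h2)
  rw [integral_of_le hR.le, integral_Ioc_eq_integral_Ioo, MeasureTheory.integral_add h1 h2] at hft
  simp only [hPR] at hft
  norm_num at hft
  linarith

/-- Test-function upper bound `μ(s) ≤ sC₁ - C₂` for the relaxed eigenvalue: the
normalized cubic test function `φ̃(z) = z³ (∫ϱ₀z⁴)^{-1/2}` lies in the constraint set
and satisfies `E(φ̃; s) = sC₁ - C₂` with `C₁, C₂ > 0`, so `μ(s) < 0` for `s < C₂/C₁`. -/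
theorem stmt7 (R K δ ε s γ : ℝ) (hR : 0 < R) (hK : 0 < K) (hδ : 0 < δ) (hε : 0 < ε)
    (hs : 0 < s) (hγ1 : 1 < γ) (hγ2 : γ < 4/3)
    (ϱ₀ : ℝ → ℝ)
    (hϱcont : ContinuousOn ϱ₀ (Icc 0 R))
    (hϱpos : ∀ z ∈ Ico (0:ℝ) R, 0 < ϱ₀ z)
    (hϱR : ϱ₀ R = 0)
    (hP₀diff : ∀ z ∈ Ioo (0:ℝ) R, DifferentiableAt ℝ (fun y => K * ϱ₀ y ^ γ) z)
    (hP₀deriv : ContinuousOn (deriv (fun y => K * ϱ₀ y ^ γ)) (Ioo 0 R))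
    (Cb : ℝ)
    (hbd : ∀ z ∈ Ioo (0:ℝ) R, |deriv (fun y => K * ϱ₀ y ^ γ) z| ≤ Cb) :
    memH R (fun z => z^3 * (∫ y in Ioo (0:ℝ) R, ϱ₀ y * y^4) ^ (-(1/2 : ℝ)))
           (fun z => 3*z^2 * (∫ y in Ioo (0:ℝ) R, ϱ₀ y * y^4) ^ (-(1/2 : ℝ))) ∧
    Jfun R ϱ₀ (fun z => z^3 * (∫ y in Ioo (0:ℝ) R, ϱ₀ y * y^4) ^ (-(1/2 : ℝ))) = 1 ∧
    Es R K γ δ ε s ϱ₀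
        (fun z => z^3 * (∫ y in Ioo (0:ℝ) R, ϱ₀ y * y^4) ^ (-(1/2 : ℝ)))
        (fun z => 3*z^2 * (∫ y in Ioo (0:ℝ) R, ϱ₀ y * y^4) ^ (-(1/2 : ℝ)))
      = s * (3*δ*R^3 / ∫ y in Ioo (0:ℝ) R, ϱ₀ y * y^4)
        - (∫ y in Ioo (0:ℝ) R, (12 - 9*γ) * K * ϱ₀ y ^ γ * y^2)
            / (∫ y in Ioo (0:ℝ) R, ϱ₀ y * y^4) ∧
    0 < 3*δ*R^3 / (∫ y in Ioo (0:ℝ) R, ϱ₀ y * y^4) ∧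
    0 < (∫ y in Ioo (0:ℝ) R, (12 - 9*γ) * K * ϱ₀ y ^ γ * y^2)
          / (∫ y in Ioo (0:ℝ) R, ϱ₀ y * y^4) ∧
    sInf ((fun p : (ℝ → ℝ) × (ℝ → ℝ) => Es R K γ δ ε s ϱ₀ p.1 p.2) ''
        {p | memH R p.1 p.2 ∧ Jfun R ϱ₀ p.1 = 1})
      ≤ s * (3*δ*R^3 / ∫ y in Ioo (0:ℝ) R, ϱ₀ y * y^4)
        - (∫ y in Ioo (0:ℝ) R, (12 - 9*γ) * K * ϱ₀ y ^ γ * y^2)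
            / (∫ y in Ioo (0:ℝ) R, ϱ₀ y * y^4) ∧
    (s < ((∫ y in Ioo (0:ℝ) R, (12 - 9*γ) * K * ϱ₀ y ^ γ * y^2)
            / (∫ y in Ioo (0:ℝ) R, ϱ₀ y * y^4))
          / (3*δ*R^3 / (∫ y in Ioo (0:ℝ) R, ϱ₀ y * y^4)) →
      sInf ((fun p : (ℝ → ℝ) × (ℝ → ℝ) => Es R K γ δ ε s ϱ₀ p.1 p.2) ''
          {p | memH R p.1 p.2 ∧ Jfun R ϱ₀ p.1 = 1}) < 0) := by
  set I := ∫ y in Ioo (0:ℝ) R, ϱ₀ y * y^4 with hI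
  set c : ℝ := I ^ (-(1/2 : ℝ)) with hc
  have hIpos : 0 < I := setIntegral_Ioo_pos hR (by fun_prop) fun z hz =>
    mul_pos (hϱpos z ⟨hz.1.le, hz.2⟩) (pow_pos hz.1 4)
  have hc2 : c ^ 2 = 1 / I := by
    rw [hc, ← Real.rpow_natCast, ← Real.rpow_mul hIpos.le]
    norm_num
    exact Real.rpow_neg_one I
  have hPcont : ContinuousOn (fun y => K * ϱ₀ y ^ γ) (Icc 0 R) :=
    continuousOn_const.mul (hϱcont.rpow_const fun _ _ => Or.inr (by linarith))
  have hmem := memH_cubic R c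
  have hJ : Jfun R ϱ₀ (fun z => z ^ 3 * c) = 1 := by
    have : Jfun R ϱ₀ (fun z => z ^ 3 * c) = ∫ z in Ioo 0 R, ϱ₀ z * z ^ 4 * c ^ 2 := by
      refine setIntegral_congr_fun measurableSet_Ioo fun z hz => ?_
      have hz0 : z ≠ 0 := hz.1.ne'
      simp only
      field_simp
    rw [this, MeasureTheory.integral_mul_const, ← hI, hc2]
    field_simp
  have hE : Es R K γ δ ε s ϱ₀ (fun z => z ^ 3 * c) (fun z => 3 * z ^ 2 * c)
      = s * (3*δ*R^3 / I) - (∫ y in Ioo (0:ℝ) R, (12 - 9*γ) * K * ϱ₀ y ^ γ * y^2) / I := by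
    obtain ⟨hGi, hG⟩ := integral_four_mul_deriv_mul_cube hR hPcont
      (by simp [hϱR, Real.zero_rpow (by linarith : γ ≠ 0)]) hP₀diff hbd
    have hQi : IntegrableOn (fun z => K * ϱ₀ z ^ γ * z ^ 2) (Ioo 0 R) :=
      (ContinuousOn.integrableOn_Icc (hPcont.mul (by fun_prop))).mono_set Ioo_subset_Icc_self
    have hsq : IntegrableOn (fun z : ℝ => z ^ 2) (Ioo 0 R) :=
      (Continuous.integrableOn_Icc (by fun_prop)).mono_set Ioo_subset_Icc_self
    have hsqv : ∫ z in Ioo 0 R, z ^ 2 = R ^ 3 / 3 := by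
      rw [← integral_Ioc_eq_integral_Ioo, ← integral_of_le hR.le, integral_pow]
      norm_num
    have hEs : Es R K γ δ ε s ϱ₀ (fun z => z ^ 3 * c) (fun z => 3 * z ^ 2 * c)
        = ∫ z in Ioo 0 R, c ^ 2 * (9 * s * δ * z ^ 2 + 9 * γ * (K * ϱ₀ z ^ γ * z ^ 2)
          + 4 * deriv (fun y => K * ϱ₀ y ^ γ) z * z ^ 3) := by
      refine setIntegral_congr_fun measurableSet_Ioo fun z hz => ?_
      have hz0 : z ≠ 0 := hz.1.ne'
      simp only
      field_simp
      ring
    have e12 : ∫ z in Ioo 0 R, 12 * (K * ϱ₀ z ^ γ) * z ^ 2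
        = 12 * ∫ z in Ioo 0 R, K * ϱ₀ z ^ γ * z ^ 2 := by
      rw [← MeasureTheory.integral_const_mul]
      simp only [mul_assoc]
    have eC : ∫ z in Ioo 0 R, (12 - 9*γ) * K * ϱ₀ z ^ γ * z^2
        = (12 - 9*γ) * ∫ z in Ioo 0 R, K * ϱ₀ z ^ γ * z ^ 2 := by
      rw [← MeasureTheory.integral_const_mul]
      simp only [mul_assoc]
    have hsum : IntegrableOn (fun z => 9 * s * δ * z ^ 2 + 9 * γ * (K * ϱ₀ z ^ γ * z ^ 2))
        (Ioo 0 R) := (hsq.const_mul _).add (hQi.const_mul _)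
    rw [hEs, MeasureTheory.integral_const_mul, MeasureTheory.integral_add hsum hGi,
      MeasureTheory.integral_add (hsq.const_mul _) (hQi.const_mul _),
      MeasureTheory.integral_const_mul, MeasureTheory.integral_const_mul, hsqv, hG, e12, eC, hc2]
    field_simp
    ring
  have hC₁ : 0 < 3*δ*R^3 / I := by positivity
  have hC₂ : 0 < (∫ y in Ioo (0:ℝ) R, (12 - 9*γ) * K * ϱ₀ y ^ γ * y^2) / I := by
    refine div_pos (setIntegral_Ioo_pos hR ?_ fun z hz => ?_) hIpos
    · simp only [mul_assoc (12 - 9 * γ)]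
      exact continuousOn_const.mul (hPcont.mul (continuousOn_pow 2))
    · have h1 := hϱpos z ⟨hz.1.le, hz.2⟩
      have h2 : 0 < 12 - 9 * γ := by linarith
      have h3 : 0 < z := hz.1
      positivity
  have hinf : sInf ((fun p : (ℝ → ℝ) × (ℝ → ℝ) => Es R K γ δ ε s ϱ₀ p.1 p.2) ''
        {p | memH R p.1 p.2 ∧ Jfun R ϱ₀ p.1 = 1})
      ≤ s * (3*δ*R^3 / I) - (∫ y in Ioo (0:ℝ) R, (12 - 9*γ) * K * ϱ₀ y ^ γ * y^2) / I :=
    csInf_le (bddBelow_Es hR hK hδ hε hs (by linarith) hϱcont hϱpos hbd)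
      ⟨(fun z => z ^ 3 * c, fun z => 3 * z ^ 2 * c), ⟨hmem, hJ⟩, hE⟩
  refine ⟨hmem, hJ, hE, hC₁, hC₂, hinf, fun hlt => hinf.trans_lt ?_⟩
  rw [lt_div_iff₀ hC₁] at hlt
  linarith
end

section
/- Let R, K, ε, δ > 0 and 6/5 < γ < 4/3. Let ϱ₀ : [0,R] → ℝ be continuous with ϱ₀ > 0 on [0,R) and ϱ₀(R) = 0, such that P₀ := K ϱ₀^γ is continuously differentiable on (0,R] and satisfies the steady-state relation P₀′(z) = −(4π ϱ₀(z)/z²) ∫₀^z ϱ₀(s) s² ds for z ∈ (0,R), and such that sup_{(0,R)} |P₀′/ϱ₀| < ∞. Then there exist λ > 0 and a function φ : (0,R] → ℝ of class C², extending continuously to [0,R] with φ(0) = 0, satisfying ∫₀^R ϱ₀(z) |φ(z)|² z^{−2} dz = 1 and ∫₀^R |φ′(z)|² z^{−2} dz < ∞, such that: (i) −d/dz[ ((4λε/3) + λδ + γ P₀(z)) φ′(z)/z² ] + 4 P₀′(z) φ(z)/z³ = −λ² ϱ₀(z) φ(z)/z² for all z ∈ (0,R); (ii) λδ φ′(R)/R²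 + (4λε/3)( φ′(R)/R² − 3 φ(R)/R³ ) = 0; and (iii) there exist C > 0 and z₁ ∈ (0,R) with |φ(z)| ≤ C z³ and |φ′(z)| ≤ C z² for all z ∈ (0, z₁]. -/
open Real MeasureTheory Set

/-- Integrating a function dominated by `N * exp (c * |t|)` gains a factor `1 / c`. -/
theorem abs_integral_le_of_abs_le_exp {F : ℝ → ℝ} {N c : ℝ} (hc : 0 < c)
    (hF : ∀ t, |F t| ≤ N * exp (c * |t|)) (z : ℝ) :
    |∫ t in (0:ℝ)..z, F t| ≤ N / c * exp (c * |z|) := by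
  have hN : 0 ≤ N := by
    have h := (abs_nonneg _).trans (hF 0)
    simpa using h
  have key : ∀ G : ℝ → ℝ, (∀ t, |G t| ≤ N * exp (c * |t|)) → ∀ z, 0 ≤ z →
      |∫ t in (0:ℝ)..z, G t| ≤ N / c * exp (c * |z|) := by
    intro G hG z hz
    have h1 : ‖∫ t in (0:ℝ)..z, G t‖ ≤ ∫ t in (0:ℝ)..z, N * exp (c * t) := by
      refine intervalIntegral.norm_integral_le_of_norm_le hz (.of_forall fun t ht => ?_)
        (Continuous.intervalIntegrable (by fun_prop) _ _)
      have := hG t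
      rwa [abs_of_pos ht.1] at this
    have hderiv : ∀ t ∈ uIcc 0 z,
        HasDerivAt (fun t => N / c * exp (c * t)) (N * exp (c * t)) t := by
      intro t _
      have h := (((hasDerivAt_id t).const_mul c).exp).const_mul (N / c)
      refine h.congr_deriv ?_
      simp only [id]
      field_simp
    rw [intervalIntegral.integral_eq_sub_of_hasDerivAt hderiv
      (Continuous.intervalIntegrable (by fun_prop) _ _)] at h1
    rw [abs_of_nonneg hz]
    have h0 : 0 ≤ N / c * exp (c * 0) := by positivity
    rw [Real.norm_eq_abs] at h1
    linarith
  rcases le_total 0 z with hz | hz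
  · exact key F hF z hz
  · have h := key (fun t => F (-t)) (fun t => by simpa using hF (-t)) (-z) (by linarith)
    rw [intervalIntegral.integral_comp_neg, neg_neg, neg_zero, abs_neg,
      intervalIntegral.integral_symm, abs_neg] at h
    exact h

/-- A Volterra equation with a bounded continuous kernel, depending continuously on a parameter,
has a solution that is jointly continuous in the parameter and the variable. -/
theorem exists_continuous_volterra {k : ℝ × ℝ × ℝ → ℝ} (hk : Continuous k) {M : ℝ}
    (hM : ∀ p, |k p| ≤ M) :
    ∃ U : ℝ × ℝ → ℝ, Continuous U ∧ ∀ l z,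
      U (l, z) = 1 + ∫ t in (0:ℝ)..z, ∫ τ in (0:ℝ)..1, k (l, t, τ) * U (l, t * τ) := by
  have hM0 : 0 ≤ M := (abs_nonneg _).trans (hM 0)
  set c : ℝ := 2 * M + 1 with hc
  have hc0 : 0 < c := by positivity
  have hinner : ∀ G : ℝ × ℝ → ℝ, Continuous G →
      Continuous fun p : ℝ × ℝ => ∫ τ in (0:ℝ)..1,
        k (p.1, p.2, τ) * (exp (c * |p.2 * τ|) * G (p.1, p.2 * τ)) := by
    intro G hG
    exact intervalIntegral.continuous_parametric_intervalIntegral_of_continuous'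
      (by unfold Function.uncurry; fun_prop) 0 1
  have hinner_le : ∀ (G : ℝ × ℝ → ℝ) (N : ℝ), (∀ p, |G p| ≤ N) → ∀ l t,
      |∫ τ in (0:ℝ)..1, k (l, t, τ) * (exp (c * |t * τ|) * G (l, t * τ))|
        ≤ M * N * exp (c * |t|) := by
    intro G N hN l t
    have h := intervalIntegral.norm_integral_le_of_norm_le_const (a := 0) (b := 1)
      (f := fun τ => k (l, t, τ) * (exp (c * |t * τ|) * G (l, t * τ)))
      (C := M * N * exp (c * |t|)) (by
        intro τ hτ
        rw [uIoc_of_le zero_le_one] at hτ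
        have h1 : |t * τ| ≤ |t| := by
          rw [abs_mul, abs_of_pos hτ.1]
          exact mul_le_of_le_one_right (abs_nonneg _) hτ.2
        rw [Real.norm_eq_abs, abs_mul, abs_mul, abs_exp]
        calc |k (l, t, τ)| * (exp (c * |t * τ|) * |G (l, t * τ)|)
            ≤ M * (exp (c * |t|) * N) := by
              gcongr
              · exact hM _
              · exact hN _
          _ = M * N * exp (c * |t|) := by ring)
    simpa using h
  have houter : ∀ G : ℝ × ℝ → ℝ, Continuous G →
      Continuous fun p : ℝ × ℝ => ∫ t in (0:ℝ)..p.2, ∫ τ in (0:ℝ)..1,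
        k (p.1, t, τ) * (exp (c * |t * τ|) * G (p.1, t * τ)) := by
    intro G hG
    refine intervalIntegral.continuous_parametric_intervalIntegral_of_continuous
      (f := fun (p : ℝ × ℝ) t => ∫ τ in (0:ℝ)..1,
        k (p.1, t, τ) * (exp (c * |t * τ|) * G (p.1, t * τ))) ?_ continuous_snd
    exact (hinner G hG).comp (continuous_fst.fst.prodMk continuous_snd)
  have houter_le : ∀ (G : ℝ × ℝ → ℝ) (N : ℝ), (∀ p, |G p| ≤ N) → ∀ p : ℝ × ℝ,
      exp (-(c * |p.2|)) * |∫ t in (0:ℝ)..p.2, ∫ τ in (0:ℝ)..1,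
        k (p.1, t, τ) * (exp (c * |t * τ|) * G (p.1, t * τ))| ≤ M * N / c := by
    intro G N hN p
    have h := abs_integral_le_of_abs_le_exp hc0 (hinner_le G N hN p.1) p.2
    calc _ ≤ exp (-(c * |p.2|)) * (M * N / c * exp (c * |p.2|)) := by gcongr
      _ = M * N / c * (exp (-(c * |p.2|)) * exp (c * |p.2|)) := by ring
      _ = M * N / c := by rw [← exp_add]; simp
  have hbound : ∀ (G : BoundedContinuousFunction (ℝ × ℝ) ℝ) (p : ℝ × ℝ),
      ‖exp (-(c * |p.2|)) * (1 + ∫ t in (0:ℝ)..p.2, ∫ τ in (0:ℝ)..1,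
        k (p.1, t, τ) * (exp (c * |t * τ|) * G (p.1, t * τ)))‖ ≤ 1 + M * ‖G‖ / c := by
    intro G p
    have h := houter_le G ‖G‖ (fun p => G.norm_coe_le_norm p) p
    rw [Real.norm_eq_abs, abs_mul, abs_exp]
    have h1 : exp (-(c * |p.2|)) ≤ 1 := by
      rw [exp_le_one_iff, neg_nonpos]; positivity
    refine (mul_le_mul_of_nonneg_left (abs_add_le _ _) (exp_pos _).le).trans ?_
    rw [mul_add, abs_one, mul_one]
    linarith
  let Φ : BoundedContinuousFunction (ℝ × ℝ) ℝ → BoundedContinuousFunction (ℝ × ℝ) ℝ :=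
    fun G => BoundedContinuousFunction.ofNormedAddCommGroup
      (fun p => exp (-(c * |p.2|)) * (1 + ∫ t in (0:ℝ)..p.2, ∫ τ in (0:ℝ)..1,
        k (p.1, t, τ) * (exp (c * |t * τ|) * G (p.1, t * τ))))
      (by have := houter G G.continuous; fun_prop) _ (hbound G)
  have hΦ : ∀ G p, Φ G p = exp (-(c * |p.2|)) * (1 + ∫ t in (0:ℝ)..p.2, ∫ τ in (0:ℝ)..1,
        k (p.1, t, τ) * (exp (c * |t * τ|) * G (p.1, t * τ))) := fun _ _ => rfl
  have hcontr : ContractingWith (1 / 2) Φ := by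
    refine ⟨by norm_num, LipschitzWith.of_dist_le_mul fun G H => ?_⟩
    refine (BoundedContinuousFunction.dist_le (by positivity)).2 fun p => ?_
    have hle := houter_le (fun p => G p - H p) (dist G H)
      (fun p => by simpa [Real.dist_eq] using G.dist_coe_le_dist (g := H) p) p
    have hin : ∀ t, (∫ τ in (0:ℝ)..1,
          k (p.1, t, τ) * (exp (c * |t * τ|) * (G (p.1, t * τ) - H (p.1, t * τ))))
        = (∫ τ in (0:ℝ)..1, k (p.1, t, τ) * (exp (c * |t * τ|) * G (p.1, t * τ)))
          - ∫ τ in (0:ℝ)..1, k (p.1, t, τ) * (exp (c * |t * τ|) * H (p.1, t * τ)) := by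
      intro t
      rw [← intervalIntegral.integral_sub (Continuous.intervalIntegrable (by fun_prop) _ _)
        (Continuous.intervalIntegrable (by fun_prop) _ _)]
      congr 1; ext τ; ring
    simp only [hin] at hle
    have hcont : ∀ G : BoundedContinuousFunction (ℝ × ℝ) ℝ, Continuous fun t => ∫ τ in (0:ℝ)..1,
        k (p.1, t, τ) * (exp (c * |t * τ|) * G (p.1, t * τ)) := fun G =>
      (hinner G G.continuous).comp (continuous_const.prodMk continuous_id)
    rw [intervalIntegral.integral_sub ((hcont G).intervalIntegrable _ _)
      ((hcont H).intervalIntegrable _ _)] at hle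
    rw [Real.dist_eq, hΦ, hΦ, ← mul_sub, add_sub_add_left_eq_sub, abs_mul, abs_exp]
    refine hle.trans ?_
    have : M / c ≤ 1 / 2 := by rw [div_le_div_iff₀ hc0 two_pos]; linarith
    have h2 := mul_le_mul_of_nonneg_right this (dist_nonneg (x := G) (y := H))
    push_cast
    calc _ = M / c * dist G H := by ring
      _ ≤ _ := h2
  set G := hcontr.fixedPoint with hG
  have hfix : Φ G = G := hcontr.fixedPoint_isFixedPt
  have hUcont : Continuous fun p : ℝ × ℝ => exp (c * |p.2|) * G p := by
    have := G.continuous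
    fun_prop
  refine ⟨fun p => exp (c * |p.2|) * G p, hUcont, fun l z => ?_⟩
  have h := hΦ G (l, z)
  rw [hfix] at h
  simp only
  rw [h, ← mul_assoc, ← exp_add]
  simp

/-- Solutions, on the box `[l₀, l₁] × [0, R]`, of `∂_z U = ∫₀¹ f(l, z, τ) U(l, z τ) dτ` with
`U(l, 0) = 1`, jointly continuous in the parameter and the variable. -/
theorem exists_continuous_volterra_family {f : ℝ × ℝ × ℝ → ℝ} (hf : Continuous f)
    {l₀ l₁ R : ℝ} (hl : l₀ ≤ l₁) (hR : 0 ≤ R) :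
    ∃ U V : ℝ × ℝ → ℝ, Continuous U ∧ Continuous V ∧ (∀ l, U (l, 0) = 1) ∧
      (∀ l z, HasDerivAt (fun z => U (l, z)) (V (l, z)) z) ∧
      ∀ l ∈ Icc l₀ l₁, ∀ z ∈ Icc 0 R,
        V (l, z) = ∫ τ in (0:ℝ)..1, f (l, z, τ) * U (l, z * τ) := by
  obtain ⟨M, hM⟩ := ((isCompact_Icc (a := l₀) (b := l₁)).prod
    ((isCompact_Icc (a := (0:ℝ)) (b := R)).prod
      (isCompact_Icc (a := (0:ℝ)) (b := 1)))).exists_bound_of_continuousOn hf.continuousOn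
  have hclamp : ∀ {a b : ℝ}, a ≤ b → ∀ x, max a (min x b) ∈ Icc a b := fun hab x =>
    ⟨le_max_left _ _, max_le hab (min_le_right _ _)⟩
  have hclamp_eq : ∀ {a b x : ℝ}, x ∈ Icc a b → max a (min x b) = x := fun hx => by
    rw [min_eq_left hx.2, max_eq_right hx.1]
  let k : ℝ × ℝ × ℝ → ℝ := fun p =>
    f (max l₀ (min p.1 l₁), max 0 (min p.2.1 R), max 0 (min p.2.2 1))
  have hk : Continuous k := by fun_prop
  obtain ⟨U, hU, hUeq⟩ := exists_continuous_volterra hk (M := M)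
    (fun p => hM _ ⟨hclamp hl _, hclamp hR _, hclamp zero_le_one _⟩)
  have hV : Continuous fun p : ℝ × ℝ => ∫ τ in (0:ℝ)..1, k (p.1, p.2, τ) * U (p.1, p.2 * τ) :=
    intervalIntegral.continuous_parametric_intervalIntegral_of_continuous'
      (by unfold Function.uncurry; fun_prop) 0 1
  refine ⟨U, _, hU, hV, fun l => by rw [hUeq]; simp, fun l z => ?_, fun l hl z hz => ?_⟩
  · have h := intervalIntegral.integral_hasDerivAt_right
      ((hV.comp (continuous_const.prodMk continuous_id)).intervalIntegrable 0 z)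
      ((hV.comp (continuous_const.prodMk continuous_id)).stronglyMeasurableAtFilter _ _)
      (hV.comp ((continuous_const (y := l)).prodMk continuous_id)).continuousAt
    have h2 := h.const_add 1
    refine h2.congr_of_eventuallyEq (.of_forall fun y => ?_)
    exact hUeq l y
  · refine intervalIntegral.integral_congr fun τ hτ => ?_
    rw [uIcc_of_le zero_le_one] at hτ
    simp only [k, hclamp_eq hl, hclamp_eq hz, hclamp_eq hτ]

/-- Backward uniqueness for the system `u' = α w`, `w' = β u`. -/
theorem eq_zero_of_linear_system {u w α β : ℝ → ℝ} {a b : ℝ} (hab : a ≤ b)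
    (hα : ContinuousOn α (Icc a b)) (hβ : ContinuousOn β (Icc a b))
    (hu : ∀ z ∈ Icc a b, HasDerivAt u (α z * w z) z)
    (hw : ∀ z ∈ Icc a b, HasDerivAt w (β z * u z) z) (hub : u b = 0) (hwb : w b = 0) :
    u a = 0 := by
  obtain ⟨C, hC⟩ := isCompact_Icc.exists_bound_of_continuousOn (hα.add hβ)
  have hE : ∀ z ∈ Icc a b, HasDerivAt (fun z => (u z ^ 2 + w z ^ 2) * exp (C * z))
      ((2 * (α z + β z) * (u z * w z) + C * (u z ^ 2 + w z ^ 2)) * exp (C * z)) z := by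
    intro z hz
    have h := (((hu z hz).pow 2).add ((hw z hz).pow 2)).mul
      (((hasDerivAt_id z).const_mul C).exp)
    refine h.congr_deriv ?_
    simp only [id, Pi.add_apply, Pi.pow_apply]
    push_cast
    ring
  have hmono : MonotoneOn (fun z => (u z ^ 2 + w z ^ 2) * exp (C * z)) (Icc a b) := by
    refine monotoneOn_of_deriv_nonneg (convex_Icc a b)
      (fun z hz => (hE z hz).continuousAt.continuousWithinAt)
      (fun z hz => (hE z (interior_subset hz)).differentiableAt.differentiableWithinAt)
      fun z hz => ?_
    rw [(hE z (interior_subset hz)).deriv]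
    refine mul_nonneg ?_ (exp_pos _).le
    have h1 : |α z + β z| ≤ C := hC z (interior_subset hz)
    have h2 := abs_le.1 h1
    nlinarith [mul_nonneg (sub_nonneg.2 h2.2) (sq_nonneg (u z - w z)),
      mul_nonneg (by linarith [h2.1] : 0 ≤ C + (α z + β z)) (sq_nonneg (u z + w z))]
  have h := hmono (left_mem_Icc.2 hab) (right_mem_Icc.2 hab) hab
  simp only [hub, hwb] at h
  have h3 : u a ^ 2 + w a ^ 2 ≤ 0 := by
    by_contra hcon
    have := mul_pos (not_le.1 hcon) (exp_pos (C * a))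
    simp at h
    linarith
  have : u a ^ 2 = 0 := by nlinarith [sq_nonneg (u a), sq_nonneg (w a)]
  exact pow_eq_zero_iff two_ne_zero |>.1 this

/-- Rescaling the averaged form of the radial flux to an integral over `[0, z]`. -/
theorem mul_integral_rescale {A z : ℝ} (hA : A ≠ 0) (hz : z ≠ 0) (g : ℝ → ℝ) :
    A * z ^ 4 * (∫ τ in (0:ℝ)..1, z / A * (τ ^ 4 * g (z * τ))) = ∫ s in (0:ℝ)..z, s ^ 4 * g s := by
  have h := intervalIntegral.integral_comp_mul_left (a := 0) (b := 1)
    (fun s => s ^ 4 * g s) hz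
  simp only [mul_zero, mul_one, smul_eq_mul] at h
  have h2 : (∫ τ in (0:ℝ)..1, (z * τ) ^ 4 * g (z * τ))
      = z ^ 4 * ∫ τ in (0:ℝ)..1, τ ^ 4 * g (z * τ) := by
    rw [← intervalIntegral.integral_const_mul]
    congr 1; ext τ; ring
  rw [h2] at h
  rw [intervalIntegral.integral_const_mul]
  field_simp at h ⊢
  linarith

/-- A solution that starts at `1` and is nondecreasing as long as it is nonnegative stays
positive. -/
theorem pos_of_deriv_nonneg_of_nonneg {u v : ℝ → ℝ} {R : ℝ} (hu0 : u 0 = 1)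
    (hu : ∀ z, HasDerivAt u (v z) z)
    (hv : ∀ z ∈ Icc 0 R, (∀ s ∈ Icc 0 z, 0 ≤ u s) → 0 ≤ v z) :
    ∀ z ∈ Icc 0 R, 0 < u z := by
  have hucont : Continuous u := continuous_iff_continuousAt.2 fun z => (hu z).continuousAt
  by_contra! hcon
  obtain ⟨z₁, hz₁, hz₁u⟩ := hcon
  have hcomp : IsCompact (Icc 0 R ∩ {z | u z ≤ 0}) :=
    isCompact_Icc.inter_right (isClosed_le hucont continuous_const)
  obtain ⟨z₀, ⟨hz₀, hz₀u⟩, hleast⟩ := hcomp.exists_isLeast ⟨z₁, hz₁, hz₁u⟩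
  have hpos : ∀ s ∈ Ico 0 z₀, 0 < u s := fun s hs => by
    by_contra hcon
    exact absurd (hleast ⟨⟨hs.1, hs.2.le.trans hz₀.2⟩, not_lt.1 hcon⟩) (not_le.2 hs.2)
  have hmono : MonotoneOn u (Icc 0 z₀) := by
    refine monotoneOn_of_deriv_nonneg (convex_Icc _ _) hucont.continuousOn
      (fun z _ => (hu z).differentiableAt.differentiableWithinAt) fun z hz => ?_
    rw [interior_Icc] at hz
    rw [(hu z).deriv]
    exact hv z ⟨hz.1.le, hz.2.le.trans hz₀.2⟩
      fun s hs => (hpos s ⟨hs.1, hs.2.trans_lt hz.2⟩).le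
  have h := hmono (left_mem_Icc.2 hz₀.1) (right_mem_Icc.2 hz₀.1) hz₀.1
  have : u z₀ ≤ 0 := hz₀u
  linarith

/-- Shooting argument in the variable `u = φ / z³`: for some growth rate `l > 0` the solution
regular at the origin is positive and meets the stress condition at `z = R`. -/
theorem exists_growing_shot {R b δ κ : ℝ} (hR : 0 < R) (hb : 0 < b) (hδ : 0 < δ) (hκ : 0 < κ)
    {ρ Q h : ℝ → ℝ} (hρ : Continuous ρ) (hQ : Continuous Q) (hh : Continuous h)
    (hρ0 : ∀ z, 0 ≤ ρ z) (hρpos : ∀ z ∈ Ico 0 R, 0 < ρ z) (hQ0 : ∀ z, 0 ≤ Q z) (hQR : Q R = 0)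
    (hhpos : ∀ z ∈ Icc 0 R, 0 < h z) :
    ∃ (l : ℝ) (u v : ℝ → ℝ), 0 < l ∧ Continuous v ∧ (∀ z, HasDerivAt u (v z) z) ∧
      (∀ z ∈ Ioc 0 R, (l * b + Q z) * z ^ 4 * v z
        = ∫ s in (0:ℝ)..z, s ^ 4 * (ρ s * (l ^ 2 - κ * h s) * u s)) ∧
      (∀ z ∈ Icc 0 R, 0 < u z) ∧ 3 * l * δ * u R + l * b * R * v R = 0 := by
  have hne : (Icc 0 R).Nonempty := nonempty_Icc.2 hR.le
  obtain ⟨zm, hzm, hmin⟩ := isCompact_Icc.exists_isMinOn hne hh.continuousOn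
  obtain ⟨zM, hzM, hmax⟩ := isCompact_Icc.exists_isMaxOn hne hh.continuousOn
  obtain ⟨m, hm, hmh⟩ : ∃ m, 0 < m ∧ ∀ z ∈ Icc 0 R, m ≤ h z := ⟨_, hhpos _ hzm, hmin⟩
  obtain ⟨H, hH, hHh⟩ : ∃ H, 0 < H ∧ ∀ z ∈ Icc 0 R, h z ≤ H := ⟨_, hhpos _ hzM, hmax⟩
  have hJ : 0 < ∫ τ in (0:ℝ)..1, τ ^ 4 * ρ (R * τ) :=
    intervalIntegral.intervalIntegral_pos_of_pos_on
      (Continuous.intervalIntegrable (by fun_prop) _ _)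
      (fun τ hτ => mul_pos (pow_pos hτ.1 4)
        (hρpos _ ⟨mul_nonneg hR.le hτ.1.le, mul_lt_of_lt_one_right hR hτ.2⟩)) zero_lt_one
  set J := ∫ τ in (0:ℝ)..1, τ ^ 4 * ρ (R * τ) with hJdef
  obtain ⟨l₀, hl₀, hl₀1, hl₀sq, hl₀δ⟩ : ∃ l₀ : ℝ, 0 < l₀ ∧ l₀ ≤ 1 ∧ l₀ ^ 2 ≤ κ * m / 2 ∧
      3 * l₀ * δ < R ^ 2 * (κ * m / 2 * J) := by
    refine ⟨min 1 (min (κ * m / 2) (R ^ 2 * (κ * m / 2 * J) / (6 * δ))), by positivity,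
      min_le_left _ _, ?_, ?_⟩
    · set x := min 1 (min (κ * m / 2) (R ^ 2 * (κ * m / 2 * J) / (6 * δ)))
      have h0 : 0 < x := by positivity
      have h1 : x ≤ 1 := min_le_left _ _
      have h2 : x ≤ κ * m / 2 := (min_le_right _ _).trans (min_le_left _ _)
      nlinarith
    · set x := min 1 (min (κ * m / 2) (R ^ 2 * (κ * m / 2 * J) / (6 * δ)))
      have h2 : x ≤ R ^ 2 * (κ * m / 2 * J) / (6 * δ) :=
        (min_le_right _ _).trans (min_le_right _ _)
      rw [le_div_iff₀ (by positivity)] at h2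
      have : 0 < R ^ 2 * (κ * m / 2 * J) := by positivity
      linarith
  set l₁ := 1 + κ * H with hl₁
  have hκH : 0 < κ * H := by positivity
  have hl01 : l₀ ≤ l₁ := by linarith
  have hl₁sq : κ * H ≤ l₁ ^ 2 := by nlinarith
  have hden : ∀ l t, 0 < max l l₀ * b + Q t := fun l t => by
    have := mul_pos (lt_max_of_lt_right hl₀ : 0 < max l l₀) hb
    linarith [hQ0 t]
  obtain ⟨U, V, hU, hV, hU0, hUV, hVeq⟩ := exists_continuous_volterra_family
    (f := fun p => p.2.1 / (max p.1 l₀ * b + Q p.2.1) *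
      (p.2.2 ^ 4 * (ρ (p.2.1 * p.2.2) * (p.1 ^ 2 - κ * h (p.2.1 * p.2.2)))))
    (by
      refine Continuous.mul (Continuous.div (by fun_prop) (by fun_prop) fun p => (hden _ _).ne')
        (by fun_prop)) hl01 hR.le
  have hVeq' : ∀ l ∈ Icc l₀ l₁, ∀ z ∈ Icc 0 R, V (l, z) = ∫ τ in (0:ℝ)..1,
      z / (l * b + Q z) * (τ ^ 4 * (ρ (z * τ) * (l ^ 2 - κ * h (z * τ)) * U (l, z * τ))) := by
    intro l hl z hz
    rw [hVeq l hl z hz]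
    congr 1; ext τ
    rw [max_eq_left hl.1]
    ring
  have hA : ∀ l ∈ Icc l₀ l₁, ∀ z, 0 < l * b + Q z := fun l hl z => by
    have := hden l z
    rwa [max_eq_left hl.1] at this
  have hflux : ∀ l ∈ Icc l₀ l₁, ∀ z ∈ Ioc 0 R, (l * b + Q z) * z ^ 4 * V (l, z)
      = ∫ s in (0:ℝ)..z, s ^ 4 * (ρ s * (l ^ 2 - κ * h s) * U (l, s)) := by
    intro l hl z hz
    rw [hVeq' l hl z (Ioc_subset_Icc_self hz)]
    exact mul_integral_rescale (hA l hl z).ne' hz.1.ne'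
      fun s => ρ s * (l ^ 2 - κ * h s) * U (l, s)
  have hmem : ∀ {z τ : ℝ}, z ∈ Icc 0 R → τ ∈ Icc (0:ℝ) 1 → z * τ ∈ Icc 0 z := fun hz hτ =>
    ⟨mul_nonneg hz.1 hτ.1, mul_le_of_le_one_right hz.1 hτ.2⟩
  set B : ℝ → ℝ := fun l => 3 * l * δ * U (l, R) + l * b * R * V (l, R) with hB
  have hBcont : Continuous B := by fun_prop
  have hinf : Continuous fun l => sInf ((fun z => U (l, z)) '' Icc 0 R) :=
    isCompact_Icc.continuous_sInf (f := fun l z => U (l, z)) hU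
  have hcontz : ∀ l, Continuous fun z => U (l, z) := fun l => by fun_prop
  -- the large parameter
  have hposΛ : ∀ z ∈ Icc 0 R, (∀ s ∈ Icc 0 z, 0 ≤ U (l₁, s)) → 0 ≤ V (l₁, z) := by
    intro z hz hs
    rw [hVeq' l₁ (right_mem_Icc.2 hl01) z hz]
    refine intervalIntegral.integral_nonneg zero_le_one fun τ hτ => ?_
    have hzτ := hmem hz hτ
    have h1 : κ * h (z * τ) ≤ κ * H :=
      mul_le_mul_of_nonneg_left (hHh _ ⟨hzτ.1, hzτ.2.trans hz.2⟩) hκ.le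
    exact mul_nonneg (div_nonneg hz.1 (hA l₁ (right_mem_Icc.2 hl01) z).le)
      (mul_nonneg (pow_nonneg hτ.1 4)
        (mul_nonneg (mul_nonneg (hρ0 _) (by linarith)) (hs _ hzτ)))
  have hUΛ := pos_of_deriv_nonneg_of_nonneg (hU0 l₁) (hUV l₁) hposΛ
  have hRmem : R ∈ Icc 0 R := right_mem_Icc.2 hR.le
  have hBΛ : 0 < B l₁ := by
    have h1 := hUΛ R hRmem
    have h2 := hposΛ R hRmem fun s hs => (hUΛ s hs).le
    have h3 : 0 < l₁ := by linarith
    have h4 : 0 < 3 * l₁ * δ * U (l₁, R) := by positivity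
    have h5 : 0 ≤ l₁ * b * R * V (l₁, R) := by positivity
    simp only [hB]
    linarith
  -- the small parameter
  have hsmall : (∀ z ∈ Icc 0 R, 0 < U (l₀, z)) → B l₀ < 0 := by
    intro hUpos
    have hcoef : ∀ s ∈ Icc 0 R, l₀ ^ 2 - κ * h s ≤ -(κ * m / 2) := fun s hs => by
      have := mul_le_mul_of_nonneg_left (hmh s hs) hκ.le
      linarith
    have hκm : 0 < κ * m := by positivity
    have hVneg : ∀ z ∈ Icc 0 R, V (l₀, z) ≤ 0 := by
      intro z hz
      rw [hVeq' l₀ (left_mem_Icc.2 hl01) z hz, ← neg_nonneg, ← intervalIntegral.integral_neg]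
      refine intervalIntegral.integral_nonneg zero_le_one fun τ hτ => ?_
      have hzτ := hmem hz hτ
      have hzτ' : z * τ ∈ Icc 0 R := ⟨hzτ.1, hzτ.2.trans hz.2⟩
      have h1 := hcoef _ hzτ'
      have h2 : 0 ≤ z / (l₀ * b + Q z) * (τ ^ 4 *
          (ρ (z * τ) * (-(l₀ ^ 2 - κ * h (z * τ))) * U (l₀, z * τ))) :=
        mul_nonneg (div_nonneg hz.1 (hA l₀ (left_mem_Icc.2 hl01) z).le)
          (mul_nonneg (pow_nonneg hτ.1 4)
            (mul_nonneg (mul_nonneg (hρ0 _) (by linarith)) (hUpos _ hzτ').le))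
      linarith
    have hanti : AntitoneOn (fun z => U (l₀, z)) (Icc 0 R) :=
      antitoneOn_of_deriv_nonpos (convex_Icc _ _) (hcontz l₀).continuousOn
        (fun z _ => (hUV l₀ z).differentiableAt.differentiableWithinAt) fun z hz => by
          rw [(hUV l₀ z).deriv]
          exact hVneg z (interior_subset hz)
    have hle : (∫ τ in (0:ℝ)..1, τ ^ 4 * (ρ (R * τ) * (l₀ ^ 2 - κ * h (R * τ)) * U (l₀, R * τ)))
        ≤ ∫ τ in (0:ℝ)..1, -(κ * m / 2) * U (l₀, R) * (τ ^ 4 * ρ (R * τ)) := by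
      refine intervalIntegral.integral_mono_on zero_le_one
        (Continuous.intervalIntegrable (by fun_prop) _ _)
        (Continuous.intervalIntegrable (by fun_prop) _ _) fun τ hτ => ?_
      have hzτ := hmem hRmem hτ
      have h1 := hcoef _ hzτ
      have h2 : U (l₀, R) ≤ U (l₀, R * τ) := hanti hzτ hRmem hzτ.2
      have h3 := hUpos R hRmem
      have h4 : (l₀ ^ 2 - κ * h (R * τ)) * U (l₀, R * τ) ≤ -(κ * m / 2) * U (l₀, R) := by
        nlinarith
      have h5 : 0 ≤ τ ^ 4 * ρ (R * τ) := mul_nonneg (pow_nonneg hτ.1 4) (hρ0 _)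
      calc _ = (τ ^ 4 * ρ (R * τ)) * ((l₀ ^ 2 - κ * h (R * τ)) * U (l₀, R * τ)) := by ring
        _ ≤ (τ ^ 4 * ρ (R * τ)) * (-(κ * m / 2) * U (l₀, R)) :=
            mul_le_mul_of_nonneg_left h4 h5
        _ = _ := by ring
    rw [intervalIntegral.integral_const_mul, ← hJdef] at hle
    have hVR : l₀ * b * R * V (l₀, R) = R ^ 2 * ∫ τ in (0:ℝ)..1,
        τ ^ 4 * (ρ (R * τ) * (l₀ ^ 2 - κ * h (R * τ)) * U (l₀, R * τ)) := by
      rw [hVeq' l₀ (left_mem_Icc.2 hl01) R hRmem, intervalIntegral.integral_const_mul, hQR,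
        add_zero]
      field_simp
    have h3 := hUpos R hRmem
    simp only [hB]
    rw [hVR]
    have h4 := mul_le_mul_of_nonneg_left hle (sq_nonneg R)
    nlinarith [mul_pos (sub_pos.2 hl₀δ) h3]
  -- intermediate value
  have hinf_le : ∀ l, ∀ z ∈ Icc 0 R, sInf ((fun z => U (l, z)) '' Icc 0 R) ≤ U (l, z) :=
    fun l z hz => csInf_le (isCompact_Icc.image (hcontz l)).bddBelow ⟨z, hz, rfl⟩
  have hinf_mem : ∀ l, ∃ z ∈ Icc 0 R, U (l, z) = sInf ((fun z => U (l, z)) '' Icc 0 R) :=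
    fun l => (isCompact_Icc.image (hcontz l)).sInf_mem (hne.image _)
  set g : ℝ → ℝ := fun l => min (sInf ((fun z => U (l, z)) '' Icc 0 R)) (B l) with hg
  have hgcont : Continuous g := hinf.min hBcont
  have hg0 : g l₀ ≤ 0 := by
    by_contra! hcon
    have h1 := lt_min_iff.1 hcon
    exact absurd (hsmall fun z hz => h1.1.trans_le (hinf_le l₀ z hz)) (not_lt.2 h1.2.le)
  have hg1 : 0 ≤ g l₁ := by
    obtain ⟨z, hz, hzeq⟩ := hinf_mem l₁
    exact le_min (hzeq ▸ (hUΛ z hz).le) hBΛ.le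
  obtain ⟨l, hl, hgl⟩ := intermediate_value_Icc hl01 hgcont.continuousOn ⟨hg0, hg1⟩
  have hlpos : 0 < l := hl₀.trans_le hl.1
  have hmin0 : 0 ≤ sInf ((fun z => U (l, z)) '' Icc 0 R) := hgl.symm.le.trans (min_le_left _ _)
  have hB0 : 0 ≤ B l := hgl.symm.le.trans (min_le_right _ _)
  have hnonneg : ∀ z ∈ Icc 0 R, 0 ≤ U (l, z) := fun z hz => hmin0.trans (hinf_le l z hz)
  have hdouble : ∀ z ∈ Icc 0 R, U (l, z) = 0 → V (l, z) ≠ 0 := by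
    intro z hz hUz hVz
    have hz0 : 0 < z := lt_of_le_of_ne hz.1 fun h0 => by
      rw [← h0, hU0] at hUz
      exact one_ne_zero hUz
    obtain ⟨a, ⟨ha0, haz⟩, hUa⟩ : ∃ a ∈ Ioo 0 z, 0 < U (l, a) := by
      have h1 : ∀ᶠ a in nhdsWithin 0 (Ioi (0:ℝ)), 0 < U (l, a) := by
        refine ((hcontz l).continuousAt.eventually_const_lt ?_).filter_mono nhdsWithin_le_nhds
        simp only [hU0, one_pos]
      obtain ⟨a, ha⟩ := (h1.and (Ioo_mem_nhdsGT hz0)).exists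
      exact ⟨a, ha.2, ha.1⟩
    have hw : Continuous fun s => s ^ 4 * (ρ s * (l ^ 2 - κ * h s) * U (l, s)) := by fun_prop
    have hzero := eq_zero_of_linear_system (u := fun s => U (l, s))
      (w := fun y => ∫ s in (0:ℝ)..y, s ^ 4 * (ρ s * (l ^ 2 - κ * h s) * U (l, s)))
      (α := fun s => ((l * b + Q s) * s ^ 4)⁻¹)
      (β := fun s => s ^ 4 * (ρ s * (l ^ 2 - κ * h s))) haz.le
      (ContinuousOn.inv₀ (by fun_prop) fun s hs =>
        (mul_pos (hA l hl s) (pow_pos (ha0.trans_le hs.1) 4)).ne')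
      (by fun_prop)
      (fun s hs => by
        have hs0 := ha0.trans_le hs.1
        refine (hUV l s).congr_deriv ?_
        rw [← hflux l hl s ⟨hs0, hs.2.trans hz.2⟩, inv_mul_cancel_left₀]
        exact (mul_pos (hA l hl s) (pow_pos hs0 4)).ne')
      (fun s _ => by
        refine (hw.integral_hasStrictDerivAt 0 s).hasDerivAt.congr_deriv ?_
        ring) hUz (by
        rw [← hflux l hl z ⟨hz0, hz.2⟩, hVz, mul_zero])
    exact hUa.ne' hzero
  have hpos : ∀ z ∈ Icc 0 R, 0 < U (l, z) := by
    intro z hz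
    refine lt_of_le_of_ne (hnonneg z hz) fun hUz => ?_
    rcases hz.2.lt_or_eq with hzR | hzR
    · have hz0 : 0 < z := lt_of_le_of_ne hz.1 fun h0 => by
        rw [← h0, hU0] at hUz
        exact zero_ne_one hUz
      have hloc : IsLocalMin (fun z => U (l, z)) z := by
        filter_upwards [Ioo_mem_nhds hz0 hzR] with s hs
        rw [← hUz]
        exact hnonneg s (Ioo_subset_Icc_self hs)
      exact hdouble z hz hUz.symm (hloc.hasDerivAt_eq_zero (hUV l z))
    · rw [hzR] at hUz
      have h1 : 0 ≤ V (l, R) := by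
        by_contra! hcon
        have : B l < 0 := by
          change 3 * l * δ * U (l, R) + l * b * R * V (l, R) < 0
          rw [← hUz, mul_zero, zero_add]
          exact mul_neg_of_pos_of_neg (by positivity) hcon
        linarith
      have h2 : V (l, R) ≤ 0 := by
        by_contra! hcon
        have h3 : ∀ᶠ s in nhdsWithin R (Iio R), U (l, s) < U (l, R) := by
          have h4 := (hasDerivAt_iff_tendsto_slope.1 (hUV l R)).mono_left
            (nhdsWithin_mono R fun s (hs : s < R) => hs.ne)
          filter_upwards [h4.eventually_const_lt hcon, self_mem_nhdsWithin] with s hs hsz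
          rw [slope_def_field] at hs
          have hsz' : s - R < 0 := sub_neg.2 hsz
          by_contra! hle
          exact absurd hs (not_lt.2 (div_nonpos_of_nonneg_of_nonpos (by linarith) hsz'.le))
        obtain ⟨s, hs1, hs2⟩ := (h3.and (Ioo_mem_nhdsLT hR)).exists
        rw [← hUz] at hs1
        exact absurd (hnonneg s (Ioo_subset_Icc_self hs2)) (not_le.2 hs1)
      exact hdouble R hRmem hUz.symm (le_antisymm h2 h1)
  refine ⟨l, fun z => U (l, z), fun z => V (l, z), hlpos, by fun_prop, hUV l, hflux l hl, hpos, ?_⟩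
  obtain ⟨z, hz, hzeq⟩ := hinf_mem l
  have h1 : 0 < sInf ((fun z => U (l, z)) '' Icc 0 R) := hzeq ▸ hpos z hz
  rcases min_choice (sInf ((fun z => U (l, z)) '' Icc 0 R)) (B l) with h2 | h2
  · exact absurd (h2.symm.trans hgl) h1.ne'
  · exact h2.symm.trans hgl

/-- Existence of a growing mode for the linearized Navier–Stokes–Poisson system around
a Lane–Emden star of radius `R` in Eulerian radial coordinates: there exist a growth
rate `λ > 0` and a normalized `C²` function `φ` on `(0,R]`, continuous up to the
boundary with `φ(0) = 0`, solving
`-∂_z[((4λε/3) + λδ + γP₀) φ'/z²] + 4P₀' φ/z³ = -λ² ϱ₀ φ/z²` on `(0,R)` with the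
normal-stress boundary condition at `z = R`, and vanishing cubically at the origin. -/
theorem stmt11 (R K ε δ γ : ℝ) (hR : 0 < R) (hK : 0 < K) (hε : 0 < ε) (hδ : 0 < δ)
    (hγ1 : (6:ℝ)/5 < γ) (hγ2 : γ < 4/3)
    (ϱ₀ P₀' : ℝ → ℝ)
    (hϱcont : ContinuousOn ϱ₀ (Icc 0 R))
    (hϱpos : ∀ z ∈ Ico (0:ℝ) R, 0 < ϱ₀ z)
    (hϱR : ϱ₀ R = 0)
    (hP₀ : ∀ z ∈ Ioc (0:ℝ) R,
      HasDerivWithinAt (fun y => K * ϱ₀ y ^ γ) (P₀' z) (Ioc 0 R) z)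
    (hP₀cont : ContinuousOn P₀' (Ioc 0 R))
    (hsteady : ∀ z ∈ Ioo (0:ℝ) R,
      P₀' z = -(4*π*ϱ₀ z/z^2) * ∫ s in (0:ℝ)..z, ϱ₀ s * s^2)
    (Cq : ℝ) (hq : ∀ z ∈ Ioo (0:ℝ) R, |P₀' z / ϱ₀ z| ≤ Cq) :
    ∃ (lam : ℝ) (φ φ' φ'' D : ℝ → ℝ), 0 < lam ∧
      ContinuousOn φ (Icc 0 R) ∧ φ 0 = 0 ∧
      (∀ z ∈ Ioc (0:ℝ) R, HasDerivWithinAt φ (φ' z) (Ioc 0 R) z) ∧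
      (∀ z ∈ Ioc (0:ℝ) R, HasDerivWithinAt φ' (φ'' z) (Ioc 0 R) z) ∧
      ContinuousOn φ'' (Ioc 0 R) ∧
      (∫ z in Ioo (0:ℝ) R, ϱ₀ z * (φ z)^2 / z^2) = 1 ∧
      IntegrableOn (fun z => (φ' z)^2 / z^2) (Ioo 0 R) ∧
      (∀ z ∈ Ioo (0:ℝ) R,
        HasDerivAt (fun y => ((4*lam*ε/3) + lam*δ + γ*(K * ϱ₀ y ^ γ)) * φ' y / y^2)
          (D z) z ∧
        -D z + 4 * P₀' z * φ z / z^3 = -(lam^2) * ϱ₀ z * φ z / z^2) ∧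
      (lam*δ*φ' R/R^2 + (4*lam*ε/3) * (φ' R/R^2 - 3*φ R/R^3) = 0) ∧
      (∃ C : ℝ, 0 < C ∧ ∃ z₁ ∈ Ioo (0:ℝ) R, ∀ z ∈ Ioc (0:ℝ) z₁,
        |φ z| ≤ C*z^3 ∧ |φ' z| ≤ C*z^2) := by
  set b : ℝ := 4 * ε / 3 + δ with hb
  have hb0 : 0 < b := by positivity
  have hγ0 : 0 < γ := by linarith
  have hκ : 0 < (4 - 3 * γ) * (4 * π) := mul_pos (by linarith) (by positivity)
  set κ : ℝ := (4 - 3 * γ) * (4 * π) with hκdef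
  obtain ⟨ρ, hρ, hρ0, hρeq⟩ : ∃ ρ : ℝ → ℝ, Continuous ρ ∧ (∀ z, 0 ≤ ρ z) ∧
      ∀ z ∈ Icc 0 R, ρ z = ϱ₀ z := by
    have hnonneg : ∀ z ∈ Icc 0 R, 0 ≤ ϱ₀ z := fun z hz => by
      rcases hz.2.lt_or_eq with h | h
      · exact (hϱpos z ⟨hz.1, h⟩).le
      · rw [h, hϱR]
    exact ⟨IccExtend hR.le ((Icc 0 R).domRestrict ϱ₀), hϱcont.domRestrict.Icc_extend',
      fun z => hnonneg _ (projIcc 0 R hR.le z).2, fun z hz => IccExtend_of_mem _ _ hz⟩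
  have hρpos : ∀ z ∈ Ico 0 R, 0 < ρ z := fun z hz => by
    rw [hρeq z (Ico_subset_Icc_self hz)]; exact hϱpos z hz
  have hRmem : R ∈ Icc 0 R := right_mem_Icc.2 hR.le
  set h : ℝ → ℝ := fun s => ∫ τ in (0:ℝ)..1, ρ (s * τ) * τ ^ 2 with hh
  have hhcont : Continuous h :=
    intervalIntegral.continuous_parametric_intervalIntegral_of_continuous'
      (f := fun s τ => ρ (s * τ) * τ ^ 2) (by unfold Function.uncurry; fun_prop) 0 1
  have hhpos : ∀ z ∈ Icc 0 R, 0 < h z := fun z hz =>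
    intervalIntegral.intervalIntegral_pos_of_pos_on
      (Continuous.intervalIntegrable (by fun_prop) _ _)
      (fun τ hτ => mul_pos (hρpos _ ⟨mul_nonneg hz.1 hτ.1.le, by
        nlinarith [hτ.1, hτ.2, hz.1, hz.2]⟩) (pow_pos hτ.1 2)) zero_lt_one
  have hP₀' : ∀ z ∈ Ioo 0 R, P₀' z = -(4 * π) * ϱ₀ z * z * h z := by
    intro z hz
    have h1 := intervalIntegral.integral_comp_mul_left (a := 0) (b := 1)
      (fun s => ρ s * s ^ 2) hz.1.ne'
    simp only [mul_zero, mul_one, smul_eq_mul] at h1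
    have h2 : (∫ τ in (0:ℝ)..1, ρ (z * τ) * (z * τ) ^ 2) = z ^ 2 * h z := by
      rw [hh, ← intervalIntegral.integral_const_mul]
      congr 1; ext τ; ring
    have h3 : (∫ s in (0:ℝ)..z, ϱ₀ s * s ^ 2) = ∫ s in (0:ℝ)..z, ρ s * s ^ 2 := by
      refine intervalIntegral.integral_congr fun s hs => ?_
      rw [uIcc_of_le hz.1.le] at hs
      simp only [hρeq s ⟨hs.1, hs.2.trans hz.2.le⟩]
    have hz0 := hz.1.ne'
    rw [hsteady z hz, h3]
    rw [h2] at h1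
    field_simp at h1 ⊢
    rw [← h1]
  set Q : ℝ → ℝ := fun z => γ * (K * ρ z ^ γ) with hQ
  have hQcont : Continuous Q :=
    continuous_const.mul (continuous_const.mul (hρ.rpow_const fun _ => Or.inr hγ0.le))
  have hQ0 : ∀ z, 0 ≤ Q z := fun z =>
    mul_nonneg hγ0.le (mul_nonneg hK.le (rpow_nonneg (hρ0 z) γ))
  have hQR : Q R = 0 := by
    simp [hQ, hρeq R hRmem, hϱR, zero_rpow hγ0.ne']
  obtain ⟨l, u, v, hl, hv, hu, hflux, hupos, hbc⟩ :=
    exists_growing_shot hR hb0 hδ hκ hρ hQcont hhcont hρ0 hρpos hQ0 hQR hhpos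
  have hucont : Continuous u := continuous_iff_continuousAt.2 fun z => (hu z).continuousAt
  have hsub : Ioc 0 R ⊆ Icc 0 R := Ioc_subset_Icc_self
  set A : ℝ → ℝ := fun y => l * b + γ * (K * ϱ₀ y ^ γ) with hA
  have hAQ : ∀ z ∈ Ioc 0 R, A z = l * b + Q z := fun z hz => by
    simp only [hA, hQ, hρeq z (hsub hz)]
  have hApos : ∀ z ∈ Ioc 0 R, 0 < A z := fun z hz => by
    rw [hAQ z hz]
    have := mul_pos hl hb0
    linarith [hQ0 z]
  have hAcont : ContinuousOn A (Ioc 0 R) :=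
    (continuous_const.add hQcont).continuousOn.congr hAQ
  have hAderiv : ∀ z ∈ Ioc 0 R, HasDerivWithinAt A (γ * P₀' z) (Ioc 0 R) z := fun z hz =>
    ((hP₀ z hz).const_mul γ).const_add _
  set w : ℝ → ℝ := fun s => s ^ 4 * (ρ s * (l ^ 2 - κ * h s) * u s) with hw
  have hwcont : Continuous w := by fun_prop
  set W : ℝ → ℝ := fun z => ∫ s in (0:ℝ)..z, w s with hW
  have hWderiv : ∀ z, HasDerivAt W (w z) z := fun z =>
    (hwcont.integral_hasStrictDerivAt 0 z).hasDerivAt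
  have hWcont : Continuous W := continuous_iff_continuousAt.2 fun z => (hWderiv z).continuousAt
  have hvW : ∀ z ∈ Ioc 0 R, A z * z ^ 4 * v z = W z := fun z hz => by
    rw [hAQ z hz]; exact hflux z hz
  have hden : ∀ z ∈ Ioc 0 R, A z * z ^ 4 ≠ 0 := fun z hz =>
    (mul_pos (hApos z hz) (pow_pos hz.1 4)).ne'
  have hvW' : ∀ z ∈ Ioc 0 R, v z = W z / (A z * z ^ 4) := fun z hz => by
    rw [eq_div_iff (hden z hz), ← hvW z hz]; ring
  set v' : ℝ → ℝ := fun z =>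
    (w z * (A z * z ^ 4) - W z * (γ * P₀' z * z ^ 4 + A z * (4 * z ^ 3))) / (A z * z ^ 4) ^ 2
    with hv'
  have hvderiv : ∀ z ∈ Ioc 0 R, HasDerivWithinAt v (v' z) (Ioc 0 R) z := by
    intro z hz
    have h1 := ((hWderiv z).hasDerivWithinAt (s := Ioc 0 R)).div
      ((hAderiv z hz).mul ((hasDerivAt_pow 4 z).hasDerivWithinAt)) (hden z hz)
    refine (h1.congr_of_mem (fun y hy => ?_) hz).congr_deriv ?_
    · exact hvW' y hy
    · simp [hv']
  have hv'cont : ContinuousOn v' (Ioc 0 R) := by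
    refine ContinuousOn.div ?_ (by fun_prop) fun z hz => pow_ne_zero 2 (hden z hz)
    fun_prop
  -- normalization
  set N : ℝ := ∫ z in (0:ℝ)..R, ρ z * (z ^ 2 * u z) ^ 2 with hN
  have hN0 : 0 < N := intervalIntegral.intervalIntegral_pos_of_pos_on
    (Continuous.intervalIntegrable (by fun_prop) _ _)
    (fun z hz => mul_pos (hρpos z (Ioo_subset_Ico_self hz))
      (pow_pos (mul_pos (pow_pos hz.1 2) (hupos z (Ioo_subset_Icc_self hz))) 2)) hR
  set c : ℝ := (√N)⁻¹ with hc
  have hcN : c ^ 2 * N = 1 := by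
    rw [hc, inv_pow, sq_sqrt hN0.le, inv_mul_cancel₀ hN0.ne']
  have hφderiv : ∀ z, HasDerivAt (fun z => c * (z ^ 3 * u z))
      (c * (3 * z ^ 2 * u z + z ^ 3 * v z)) z := fun z => by
    refine (((hasDerivAt_pow 3 z).mul (hu z)).const_mul c).congr_deriv ?_
    push_cast
    ring
  obtain ⟨C₁, hC₁⟩ := (isCompact_Icc (a := 0) (b := R)).exists_bound_of_continuousOn
    (f := fun z => c * u z) (by fun_prop)
  obtain ⟨C₂, hC₂⟩ := (isCompact_Icc (a := 0) (b := R)).exists_bound_of_continuousOn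
    (f := fun z => c * (3 * u z + z * v z)) (by fun_prop)
  refine ⟨l, fun z => c * (z ^ 3 * u z), fun z => c * (3 * z ^ 2 * u z + z ^ 3 * v z),
    fun z => c * (6 * z * u z + 6 * z ^ 2 * v z + z ^ 3 * v' z),
    fun z => 4 * P₀' z * (c * (z ^ 3 * u z)) / z ^ 3
      + l ^ 2 * ϱ₀ z * (c * (z ^ 3 * u z)) / z ^ 2,
    hl, by fun_prop, by simp, fun z _ => (hφderiv z).hasDerivWithinAt, fun z hz => ?_,
    by fun_prop, ?_, ?_, fun z hz => ⟨?_, by ring⟩, ?_, ?_⟩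
  · have h1 := (hasDerivAt_pow 2 z).const_mul 3 |>.mul (hu z)
    have h2 := (hasDerivAt_pow 3 z).hasDerivWithinAt (s := Ioc 0 R) |>.mul (hvderiv z hz)
    refine ((h1.hasDerivWithinAt.add h2).const_mul c).congr_deriv ?_
    push_cast
    ring
  · have h1 : (∫ z in Ioo 0 R, ϱ₀ z * (c * (z ^ 3 * u z)) ^ 2 / z ^ 2)
        = ∫ z in Ioo 0 R, c ^ 2 * (ρ z * (z ^ 2 * u z) ^ 2) := by
      refine setIntegral_congr_fun measurableSet_Ioo fun z hz => ?_
      have hz0 := hz.1.ne'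
      simp only [hρeq z (Ioo_subset_Icc_self hz)]
      field_simp
    rw [h1, ← integral_Ioc_eq_integral_Ioo, ← intervalIntegral.integral_of_le hR.le,
      intervalIntegral.integral_const_mul, hcN]
  · have h1 : Continuous fun z => (c * (3 * z * u z + z ^ 2 * v z)) ^ 2 := by fun_prop
    refine ((h1.integrableOn_Icc (a := 0) (b := R)).mono_set Ioo_subset_Icc_self).congr_fun
      (fun z hz => ?_) measurableSet_Ioo
    have hz0 := hz.1.ne'
    field_simp
  · have hz' : z ∈ Ioc 0 R := Ioo_subset_Ioc_self hz
    have hz0 := hz.1.ne'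
    have hnhds : Ioc 0 R ∈ nhds z := Ioc_mem_nhds hz.1 hz.2
    have h1 := (hAderiv z hz').hasDerivAt hnhds
    have h2 := (((h1.const_mul 3).mul (hu z)).add
      ((hWderiv z).div (hasDerivAt_pow 3 z) (pow_ne_zero 3 hz0))).const_mul c
    refine (h2.congr_of_eventuallyEq ?_).congr_deriv ?_
    · filter_upwards [hnhds] with y hy
      have hy0 := hy.1.ne'
      simp only [Pi.add_apply, Pi.mul_apply, Pi.div_apply, ← hvW y hy, hA, hb]
      field_simp
    · simp only [hw, ← hvW z hz', hP₀' z hz, hρeq z (Ioo_subset_Icc_self hz), hκdef]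
      push_cast
      field_simp
      ring
  · have hR0 := hR.ne'
    rw [hb] at hbc
    field_simp at hbc ⊢
    linear_combination c * hbc
  · refine ⟨max 1 (max C₁ C₂), by positivity, R / 2, ⟨by linarith, by linarith⟩, fun z hz => ?_⟩
    have hz' : z ∈ Icc 0 R := ⟨hz.1.le, by linarith [hz.2]⟩
    have h1 : |c * u z| ≤ max 1 (max C₁ C₂) := (hC₁ z hz').trans (by simp)
    have h2 : |c * (3 * u z + z * v z)| ≤ max 1 (max C₁ C₂) := (hC₂ z hz').trans (by simp)
    constructor <;> beta_reduce
    · rw [show c * (z ^ 3 * u z) = c * u z * z ^ 3 by ring, abs_mul, abs_of_pos (pow_pos hz.1 3)]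
      exact mul_le_mul_of_nonneg_right h1 (pow_pos hz.1 3).le
    · rw [show c * (3 * z ^ 2 * u z + z ^ 3 * v z) = c * (3 * u z + z * v z) * z ^ 2 by ring,
        abs_mul, abs_of_pos (pow_pos hz.1 2)]
      exact mul_le_mul_of_nonneg_right h2 (pow_pos hz.1 2).le
end

section
/- Let V be a real vector space equipped with two symmetric positive semidefinite bilinear forms B₁ and B₂, and write N_i(x) = √(B_i(x,x)). Let λ > 0 and K₀ ≥ 0. Let φ, φ′ : [0,∞) → V be such that for i = 1,2 the maps t ↦ B_i(φ(t), φ(t)) are continuously differentiable with derivative 2 B_i(φ(t), φ′(t)), and the maps t ↦ B_i(φ′(t), φ′(t)) are continuous. Assume that for all t ≥ 0: (1/2) N₁(φ′(t))² + ∫₀^t N₂(φ′(s))² ds ≤ K₀ + (λ²/2) N₁(φ(t))² + (λ/2) N₂(φ(t))². Then, with K₁ = 2K₀/λ + 2 N₂(φ(0))², for all t ≥ 0: (i) N₁(φ(t))² + ∫₀^t N₂(φ(s))² ds ≤ e^{2λt} N₁(φ(0))² + (K₁/(2λ))(e^{2λt} − 1); and (ii) (1/λ) N₁(φ′(t))²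 + N₂(φ(t))² ≤ e^{2λt} ( 2λ N₁(φ(0))² + K₁ ). -/
open Real MeasureTheory Set

theorem hasDerivWithinAt_integral_Ici {g : ℝ → ℝ} {a t : ℝ} (hg : ContinuousOn g (Ici a))
    (ht : t ∈ Ici a) :
    HasDerivWithinAt (fun u => ∫ s in a..u, g s) (g t) (Ici a) t := by
  have hcont : Continuous fun s => g (max a s) :=
    hg.comp_continuous (continuous_const.max continuous_id) fun s => le_max_left a s
  have hderiv := (hcont.integral_hasStrictDerivAt a t).hasDerivAt.hasDerivWithinAt (s := Ici a)
  have heq : ∀ u ∈ Ici a, (∫ s in a..u, g s) = ∫ s in a..u, g (max a s) := by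
    intro u hu
    refine intervalIntegral.integral_congr fun s hs => ?_
    rw [uIcc_of_le hu] at hs
    simp only [max_eq_right hs.1]
  simp only [max_eq_right (mem_Ici.mp ht)] at hderiv
  exact hderiv.congr heq (heq t ht)

theorem le_of_hasDerivWithinAt_Ici_nonpos {f f' : ℝ → ℝ} {a t : ℝ}
    (hf : ∀ s ∈ Ici a, HasDerivWithinAt f (f' s) (Ici a) s) (hf' : ∀ s ∈ Ici a, f' s ≤ 0)
    (ht : t ∈ Ici a) : f t ≤ f a :=
  antitoneOn_of_hasDerivWithinAt_nonpos (convex_Ici a)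
    (fun s hs => (hf s hs).continuousWithinAt)
    (fun s hs => (hf s (interior_subset hs)).mono interior_subset)
    (fun s hs => hf' s (interior_subset hs)) self_mem_Ici ht ht

/-- Grönwall's inequality for a differential inequality `f' ≤ c f + k` on `[0, ∞)`. -/
theorem le_exp_of_hasDerivWithinAt_le {f f' : ℝ → ℝ} {c k t : ℝ} (hc : c ≠ 0)
    (hf : ∀ s ∈ Ici (0 : ℝ), HasDerivWithinAt f (f' s) (Ici 0) s)
    (hf' : ∀ s ∈ Ici (0 : ℝ), f' s ≤ c * f s + k) (ht : t ∈ Ici (0 : ℝ)) :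
    f t ≤ Real.exp (c * t) * f 0 + k / c * (Real.exp (c * t) - 1) := by
  have hderiv : ∀ s ∈ Ici (0 : ℝ), HasDerivWithinAt
      (fun u => Real.exp (-(c * u)) * (f u + k / c))
      (Real.exp (-(c * s)) * (f' s - (c * f s + k))) (Ici 0) s := by
    intro s hs
    have hexp : HasDerivAt (fun u => Real.exp (-(c * u))) (Real.exp (-(c * s)) * (-(c * 1))) s :=
      (((hasDerivAt_id s).const_mul c).neg).exp
    refine (hexp.hasDerivWithinAt.mul ((hf s hs).add_const (k / c))).congr_deriv ?_
    field_simp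
    ring
  have hle := le_of_hasDerivWithinAt_Ici_nonpos hderiv
    (fun s hs => mul_nonpos_of_nonneg_of_nonpos (Real.exp_pos _).le
      (sub_nonpos.mpr (hf' s hs))) ht
  have hmul := mul_le_mul_of_nonneg_left hle (Real.exp_pos (c * t)).le
  simp only [← mul_assoc, ← Real.exp_add, add_neg_cancel, mul_zero, neg_zero, Real.exp_zero,
    one_mul] at hmul
  linarith

/-- Weighted Young inequality for a positive semidefinite symmetric bilinear form. -/
theorem two_mul_bilin_le {V : Type*} [AddCommGroup V] [Module ℝ V] (B : V →ₗ[ℝ] V →ₗ[ℝ] ℝ)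
    (hsym : ∀ x y : V, B x y = B y x) (hpsd : ∀ x : V, 0 ≤ B x x) {c : ℝ} (hc : 0 < c)
    (x y : V) : 2 * B x y ≤ c * B x x + (1 / c) * B y y := by
  have h := hpsd (c • x - y)
  simp only [map_sub, map_smul, LinearMap.sub_apply, LinearMap.smul_apply, smul_eq_mul,
    hsym y x] at h
  have hdiv : 0 ≤ (1 / c) * (c * (c * B x x - B x y) - (c * B x y - B y y)) :=
    mul_nonneg (by positivity) (by linarith)
  have heq : (1 / c) * (c * (c * B x x - B x y) - (c * B x y - B y y))
      = c * B x x + (1 / c) * B y y - 2 * B x y := by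
    field_simp
    ring
  linarith

/-- Abstract core of the sharp linear growth estimate: `B₁, B₂` are symmetric positive
semidefinite bilinear forms on a real vector space, with squared seminorms
`N_i(x)² = B_i(x,x)`. If `t ↦ B_i(φ(t),φ(t))` is differentiable with derivative
`2B_i(φ(t),φ'(t))`, `t ↦ B_i(φ'(t),φ'(t))` is continuous, and
`(1/2)N₁(φ')² + ∫₀^t N₂(φ')² ≤ K₀ + (λ²/2)N₁(φ)² + (λ/2)N₂(φ)²` for all `t ≥ 0`,
then with `K₁ = 2K₀/λ + 2N₂(φ(0))²`:
(i) `N₁(φ(t))² + ∫₀^t N₂(φ(s))² ds ≤ e^{2λt}N₁(φ(0))² + (K₁/(2λ))(e^{2λt}-1)`, and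
(ii) `(1/λ)N₁(φ'(t))² + N₂(φ(t))² ≤ e^{2λt}(2λN₁(φ(0))² + K₁)`. -/
theorem stmt13 {V : Type*} [AddCommGroup V] [Module ℝ V]
    (B₁ B₂ : V →ₗ[ℝ] V →ₗ[ℝ] ℝ)
    (hsym₁ : ∀ x y : V, B₁ x y = B₁ y x) (hsym₂ : ∀ x y : V, B₂ x y = B₂ y x)
    (hpsd₁ : ∀ x : V, 0 ≤ B₁ x x) (hpsd₂ : ∀ x : V, 0 ≤ B₂ x x)
    (lam K₀ : ℝ) (hlam : 0 < lam) (hK₀ : 0 ≤ K₀)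
    (φ φ' : ℝ → V)
    (hd₁ : ∀ t ∈ Ici (0:ℝ),
      HasDerivWithinAt (fun s => B₁ (φ s) (φ s)) (2 * B₁ (φ t) (φ' t)) (Ici 0) t)
    (hd₂ : ∀ t ∈ Ici (0:ℝ),
      HasDerivWithinAt (fun s => B₂ (φ s) (φ s)) (2 * B₂ (φ t) (φ' t)) (Ici 0) t)
    (hc₁ : ContinuousOn (fun t => B₁ (φ' t) (φ' t)) (Ici 0))
    (hc₂ : ContinuousOn (fun t => B₂ (φ' t) (φ' t)) (Ici 0))
    (hmain : ∀ t ∈ Ici (0:ℝ),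
      (1/2) * B₁ (φ' t) (φ' t) + (∫ s in (0:ℝ)..t, B₂ (φ' s) (φ' s))
        ≤ K₀ + (lam^2/2) * B₁ (φ t) (φ t) + (lam/2) * B₂ (φ t) (φ t)) :
    ∀ t ∈ Ici (0:ℝ),
      (B₁ (φ t) (φ t) + (∫ s in (0:ℝ)..t, B₂ (φ s) (φ s))
        ≤ Real.exp (2*lam*t) * B₁ (φ 0) (φ 0)
          + (2*K₀/lam + 2 * B₂ (φ 0) (φ 0))/(2*lam) * (Real.exp (2*lam*t) - 1)) ∧
      ((1/lam) * B₁ (φ' t) (φ' t) + B₂ (φ t) (φ t)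
        ≤ Real.exp (2*lam*t)
            * (2*lam * B₁ (φ 0) (φ 0) + (2*K₀/lam + 2 * B₂ (φ 0) (φ 0)))) := by
  have hcφ : ContinuousOn (fun s => B₂ (φ s) (φ s)) (Ici 0) :=
    fun s hs => (hd₂ s hs).continuousWithinAt
  have hb : ∀ t ∈ Ici (0 : ℝ), B₂ (φ t) (φ t) ≤ B₂ (φ 0) (φ 0)
      + lam * (∫ s in (0 : ℝ)..t, B₂ (φ s) (φ s))
      + (1 / lam) * ∫ s in (0 : ℝ)..t, B₂ (φ' s) (φ' s) := by
    intro t ht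
    have h := le_of_hasDerivWithinAt_Ici_nonpos
      (f := fun t => B₂ (φ t) (φ t) - lam * (∫ s in (0 : ℝ)..t, B₂ (φ s) (φ s))
        - (1 / lam) * ∫ s in (0 : ℝ)..t, B₂ (φ' s) (φ' s))
      (fun s hs => ((hd₂ s hs).sub ((hasDerivWithinAt_integral_Ici hcφ hs).const_mul lam)).sub
        ((hasDerivWithinAt_integral_Ici hc₂ hs).const_mul (1 / lam)))
      (fun s _ => by linarith [two_mul_bilin_le B₂ hsym₂ hpsd₂ hlam (φ s) (φ' s)]) ht
    simp only [intervalIntegral.integral_same] at h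
    linarith
  have hkey : ∀ t ∈ Ici (0 : ℝ), (1 / lam) * B₁ (φ' t) (φ' t) + B₂ (φ t) (φ t)
      ≤ lam * B₁ (φ t) (φ t) + 2 * lam * (∫ s in (0 : ℝ)..t, B₂ (φ s) (φ s))
        + (2 * K₀ / lam + 2 * B₂ (φ 0) (φ 0)) := by
    intro t ht
    have h := mul_le_mul_of_nonneg_left (hmain t ht) (by positivity : 0 ≤ 2 / lam)
    have hl : 2 / lam * ((1/2) * B₁ (φ' t) (φ' t) + ∫ s in (0 : ℝ)..t, B₂ (φ' s) (φ' s))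
        = (1 / lam) * B₁ (φ' t) (φ' t)
          + 2 * ((1 / lam) * ∫ s in (0 : ℝ)..t, B₂ (φ' s) (φ' s)) := by ring
    have hr : 2 / lam * (K₀ + (lam^2/2) * B₁ (φ t) (φ t) + (lam/2) * B₂ (φ t) (φ t))
        = 2 * K₀ / lam + lam * B₁ (φ t) (φ t) + B₂ (φ t) (φ t) := by field_simp
    linarith [hb t ht]
  intro t ht
  have hgrowth := le_exp_of_hasDerivWithinAt_le (c := 2 * lam)
    (k := 2 * K₀ / lam + 2 * B₂ (φ 0) (φ 0))
    (f := fun t => B₁ (φ t) (φ t) + ∫ s in (0 : ℝ)..t, B₂ (φ s) (φ s)) (by positivity)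
    (fun s hs => (hd₁ s hs).add (hasDerivWithinAt_integral_Ici hcφ hs))
    (fun s hs => by
      linarith [two_mul_bilin_le B₁ hsym₁ hpsd₁ hlam (φ s) (φ' s), hkey s hs]) ht
  simp only [intervalIntegral.integral_same, add_zero] at hgrowth
  refine ⟨hgrowth, ?_⟩
  have h := mul_le_mul_of_nonneg_left hgrowth (by positivity : 0 ≤ 2 * lam)
  have hcancel : 2 * lam * ((2 * K₀ / lam + 2 * B₂ (φ 0) (φ 0)) / (2 * lam)
      * (Real.exp (2 * lam * t) - 1))
      = (2 * K₀ / lam + 2 * B₂ (φ 0) (φ 0)) * (Real.exp (2 * lam * t) - 1) := by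
    field_simp
  have hpos := mul_nonneg hlam.le (hpsd₁ (φ t))
  linarith [hkey t ht]
end
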